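/- arXiv:math/0312453 — 3 statements merged into one kernel-verified Lean document; each statement's English description precedes it below -/
import Mathlib

section
/- Let p, n be positive integers with 2n < p. In the polynomial ring ℂ[x_{k,i} : 1 ≤ k ≤ p, 1 ≤ i ≤ n], let J⁺ be the ideal generated by the n(n+1)/2 polynomials q_{i,j} = ∑_{k=1}^p x_{k,i} x_{k,j} for 1 ≤ i ≤ j ≤ n. Then J⁺ is a prime ideal, and the quotient ring ℂ[x_{k,i}]/J⁺ is an integrally closed integral domain (i.e. the null cone {A ∈ M_{p,n}(ℂ) : AᵀA = 0} is an irreducible normal affine variety). -/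
open MvPolynomial

/-- The ideal of the null cone `{A ∈ M_{p,n}(ℂ) : AᵀA = 0}`, generated by the
quadratic invariants `q_{i,j} = ∑_k x_{k,i} x_{k,j}` for `i ≤ j`. -/
noncomputable def nullConeIdealO (p n : ℕ) :
    Ideal (MvPolynomial (Fin p × Fin n) ℂ) :=
  Ideal.span
    {f | ∃ i j : Fin n, i ≤ j ∧ f = ∑ k : Fin p, X (k, i) * X (k, j)}

section LeadingMonomials

variable {σ R A : Type*} [CommRing R]

/-- `p` is the monomial `d` plus terms of strictly smaller weight. -/
def LeadsWith (w : σ → ℕ) (p : MvPolynomial σ R) (d : σ →₀ ℕ) : Prop :=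
  ∀ e ∈ (p - monomial d 1).support, Finsupp.weight w e < Finsupp.weight w d

lemma LeadsWith.monomial (w : σ → ℕ) (d : σ →₀ ℕ) :
    LeadsWith w (monomial d (1 : R)) d := by
  simp [LeadsWith]

lemma LeadsWith.mul {w : σ → ℕ} {p q : MvPolynomial σ R} {d e : σ →₀ ℕ}
    (hp : LeadsWith w p d) (hq : LeadsWith w q e) : LeadsWith w (p * q) (d + e) := by
  classical
  intro c hc
  have key : p * q - MvPolynomial.monomial (d + e) 1 =
      (p - MvPolynomial.monomial d 1) * (q - MvPolynomial.monomial e 1) +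
        (MvPolynomial.monomial d 1 * (q - MvPolynomial.monomial e 1) +
        (p - MvPolynomial.monomial d 1) * MvPolynomial.monomial e 1) := by
    rw [← mul_one (1 : R), ← monomial_mul, mul_one]; ring
  rw [key] at hc
  have hmon (d : σ →₀ ℕ) {a : σ →₀ ℕ}
      (ha : a ∈ (MvPolynomial.monomial d (1 : R)).support) : a = d := by
    simpa using support_monomial_subset ha
  rcases Finset.mem_union.1 (support_add hc) with h | h
  · obtain ⟨a, ha, b, hb, rfl⟩ := Finset.mem_add.1 (support_mul _ _ h)
    have := hp a ha
    have := hq b hb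
    simp only [map_add]; omega
  rcases Finset.mem_union.1 (support_add h) with h | h
  · obtain ⟨a, ha, b, hb, rfl⟩ := Finset.mem_add.1 (support_mul _ _ h)
    have := hq b hb
    rw [hmon d ha]
    simp only [map_add]; omega
  · obtain ⟨a, ha, b, hb, rfl⟩ := Finset.mem_add.1 (support_mul _ _ h)
    have := hp a ha
    rw [hmon e hb]
    simp only [map_add]; omega

lemma LeadsWith.pow {w : σ → ℕ} {p : MvPolynomial σ R} {d : σ →₀ ℕ}
    (hp : LeadsWith w p d) (k : ℕ) : LeadsWith w (p ^ k) (k • d) := by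
  induction k with
  | zero => simpa using LeadsWith.monomial (R := R) w 0
  | succ k ih => rw [pow_succ, succ_nsmul]; exact ih.mul hp

lemma LeadsWith.prod {w : σ → ℕ} (s : Finset A) {p : A → MvPolynomial σ R} {d : A → σ →₀ ℕ}
    (hp : ∀ a, LeadsWith w (p a) (d a)) : LeadsWith w (∏ a ∈ s, p a) (∑ a ∈ s, d a) := by
  classical
  induction s using Finset.induction_on with
  | empty => simpa using LeadsWith.monomial (R := R) w 0
  | insert a s ha ih => rw [Finset.prod_insert ha, Finset.sum_insert ha]; exact (hp a).mul ih

/-- The largest `k` such that `k • m ≤ d`, for `m ≠ 0`. -/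
def monomialOrd (m d : σ →₀ ℕ) : ℕ :=
  if h : m.support.Nonempty then m.support.inf' h fun i => d i / m i else 0

lemma monomialOrd_mul_le (m d : σ →₀ ℕ) (i : σ) : monomialOrd m d * m i ≤ d i := by
  unfold monomialOrd
  split_ifs with h
  · by_cases hi : i ∈ m.support
    · exact (Nat.mul_le_mul_right _ (Finset.inf'_le _ hi)).trans (Nat.div_mul_le_self _ _)
    · simp [Finsupp.notMem_support_iff.1 hi]
  · simp

lemma monomialOrd_add_self {m : σ →₀ ℕ} (hm : m ≠ 0) (d : σ →₀ ℕ) :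
    monomialOrd m (d + m) = monomialOrd m d + 1 := by
  have h : m.support.Nonempty := Finsupp.support_nonempty_iff.2 hm
  have key : ∀ i ∈ m.support, (d + m) i / m i = d i / m i + 1 := fun i hi => by
    rw [Finsupp.add_apply, Nat.add_div_right _ (Nat.pos_of_ne_zero (Finsupp.mem_support_iff.1 hi))]
  simp only [monomialOrd, dif_pos h]
  rw [Finset.inf'_congr h rfl key]
  obtain ⟨i, hi, hi'⟩ := Finset.exists_mem_eq_inf' h fun i => d i / m i
  apply le_antisymm
  · rw [hi']
    exact Finset.inf'_le (fun i => d i / m i + 1) hi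
  · exact Finset.le_inf' _ _ fun j hj => Nat.succ_le_succ (Finset.inf'_le _ hj)

lemma monomialOrd_add_of_disjoint {m m' : σ →₀ ℕ} (h : Disjoint m.support m'.support)
    (d : σ →₀ ℕ) : monomialOrd m (d + m') = monomialOrd m d := by
  unfold monomialOrd
  split_ifs with hm
  · refine Finset.inf'_congr hm rfl fun i hi => ?_
    have : m' i = 0 := Finsupp.notMem_support_iff.1 (Finset.disjoint_left.1 h hi)
    simp [this]
  · rfl

variable [Fintype A]

lemma sum_monomialOrd_le {m : A → σ →₀ ℕ}
    (hd : Pairwise fun a b => Disjoint (m a).support (m b).support) (d : σ →₀ ℕ) :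
    ∑ a, monomialOrd (m a) d • m a ≤ d := by
  intro i
  rw [Finsupp.finsetSum_apply]
  by_cases h : ∃ a, m a i ≠ 0
  · obtain ⟨a, ha⟩ := h
    rw [Finset.sum_eq_single_of_mem a (Finset.mem_univ a)]
    · simpa using monomialOrd_mul_le (m a) d i
    · intro b _ hb
      have : m b i = 0 := Finsupp.notMem_support_iff.1
        (Finset.disjoint_left.1 (hd hb.symm) (Finsupp.mem_support_iff.2 ha))
      simp [this]
  · push Not at h
    simp [h]

/-- The linear endomorphism replacing, in each monomial, the maximal powers of the monomials
`m a` by the same powers of the polynomials `f a`. -/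
noncomputable def substLeading (m : A → σ →₀ ℕ) (f : A → MvPolynomial σ R) :
    MvPolynomial σ R →ₗ[R] MvPolynomial σ R :=
  (basisMonomials σ R).constr R fun d =>
    (∏ a, f a ^ monomialOrd (m a) d) * monomial (d - ∑ a, monomialOrd (m a) d • m a) 1

lemma substLeading_monomial (m : A → σ →₀ ℕ) (f : A → MvPolynomial σ R) (d : σ →₀ ℕ) :
    substLeading m f (monomial d 1) =
      (∏ a, f a ^ monomialOrd (m a) d) * monomial (d - ∑ a, monomialOrd (m a) d • m a) 1 := by
  have := (basisMonomials σ R).constr_basis R (fun d => (∏ a, f a ^ monomialOrd (m a) d) *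
    monomial (d - ∑ a, monomialOrd (m a) d • m a) 1) d
  simpa [substLeading] using this

variable {w : σ → ℕ} {m : A → σ →₀ ℕ} {f : A → MvPolynomial σ R}

lemma substLeading_mul (hm : ∀ a, m a ≠ 0)
    (hd : Pairwise fun a b => Disjoint (m a).support (m b).support)
    (a : A) (p : MvPolynomial σ R) :
    substLeading m f (monomial (m a) 1 * p) = f a * substLeading m f p := by
  classical
  induction p using MvPolynomial.induction_on' with
  | monomial d r =>
    have hr (e : σ →₀ ℕ) : (monomial e r : MvPolynomial σ R) = r • monomial e 1 := by
      simp [smul_monomial]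
    rw [hr d, mul_smul_comm, map_smul, map_smul, mul_smul_comm, monomial_mul, mul_one, add_comm,
      substLeading_monomial, substLeading_monomial]
    have hord (b : A) : monomialOrd (m b) (d + m a) =
        monomialOrd (m b) d + if b = a then 1 else 0 := by
      split_ifs with h
      · rw [h, monomialOrd_add_self (hm a)]
      · rw [monomialOrd_add_of_disjoint (hd h), add_zero]
    simp only [hord, pow_add, add_smul, Finset.prod_mul_distrib, Finset.sum_add_distrib]
    simp only [pow_ite, pow_one, pow_zero, ite_smul, one_smul, zero_smul, Finset.prod_ite_eq',
      Finset.sum_ite_eq', Finset.mem_univ, if_true]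
    rw [add_tsub_add_eq_tsub_right]
    congr 1
    ring
  | add p q hp hq => rw [mul_add, map_add, map_add, hp, hq, mul_add]

lemma substLeading_leadsWith (hd : Pairwise fun a b => Disjoint (m a).support (m b).support)
    (hf : ∀ a, LeadsWith w (f a) (m a)) (d : σ →₀ ℕ) :
    LeadsWith w (substLeading m f (monomial d 1)) d := by
  rw [substLeading_monomial]
  have := (LeadsWith.prod (R := R) Finset.univ fun a => (hf a).pow (monomialOrd (m a) d)).mul
    (LeadsWith.monomial w (d - ∑ a, monomialOrd (m a) d • m a))
  rwa [add_tsub_cancel_of_le (sum_monomialOrd_le hd d)] at this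

lemma substLeading_injective
    (hd : Pairwise fun a b => Disjoint (m a).support (m b).support)
    (hf : ∀ a, LeadsWith w (f a) (m a)) : Function.Injective (substLeading m f) := by
  classical
  rw [injective_iff_map_eq_zero]
  intro p hp
  by_contra hne
  obtain ⟨d, hdp, hmax⟩ := p.support.exists_max_image (Finsupp.weight w)
    (Finset.nonempty_iff_ne_empty.2 fun h => hne (support_eq_empty.1 h))
  apply mem_support_iff.1 hdp
  have hsum : p = ∑ e ∈ p.support, coeff e p • monomial e 1 := by
    conv_lhs => rw [p.as_sum]
    simp [smul_monomial]
  have hdiff : substLeading m f p - p =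
      ∑ e ∈ p.support, coeff e p • (substLeading m f (monomial e 1) - monomial e 1) := by
    have hsum' : substLeading m f p =
        ∑ e ∈ p.support, coeff e p • substLeading m f (monomial e 1) := by
      conv_lhs => rw [hsum]
      simp only [map_sum, map_smul]
    simp only [smul_sub, Finset.sum_sub_distrib]
    rw [← hsum, ← hsum']
  have := congrArg (coeff d) hdiff
  rw [hp, zero_sub, coeff_neg, coeff_sum, Finset.sum_eq_zero, neg_eq_zero] at this
  · exact this
  · intro e he
    rw [coeff_smul, smul_eq_mul]
    by_cases h : d ∈ (substLeading m f (monomial e 1) - monomial e 1).support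
    · exact absurd (substLeading_leadsWith hd hf e d h) (hmax e he).not_gt
    · rw [notMem_support_iff.1 h, mul_zero]

lemma substLeading_surjective
    (hd : Pairwise fun a b => Disjoint (m a).support (m b).support)
    (hf : ∀ a, LeadsWith w (f a) (m a)) : Function.Surjective (substLeading m f) := by
  rw [← LinearMap.range_eq_top]
  have hmon : ∀ (N : ℕ) (d : σ →₀ ℕ), Finsupp.weight w d = N →
      monomial d (1 : R) ∈ LinearMap.range (substLeading m f) := by
    intro N
    induction N using Nat.strong_induction_on with
    | _ N ih =>
      rintro d rfl
      set q := substLeading m f (monomial d 1) - monomial d 1 with hq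
      have hqr : q ∈ LinearMap.range (substLeading m f) := by
        rw [q.as_sum]
        refine Submodule.sum_mem _ fun e he => ?_
        have : (monomial e (coeff e q) : MvPolynomial σ R) = coeff e q • monomial e 1 := by
          simp [smul_monomial]
        rw [this]
        exact Submodule.smul_mem _ _ (ih _ (substLeading_leadsWith hd hf d e he) e rfl)
      have : monomial d (1 : R) = substLeading m f (monomial d 1) - q := by rw [hq]; ring
      rw [this]
      exact Submodule.sub_mem _ ⟨_, rfl⟩ hqr
  rw [eq_top_iff]
  rintro p -
  rw [p.as_sum]
  refine Submodule.sum_mem _ fun e _ => ?_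
  have : (monomial e (coeff e p) : MvPolynomial σ R) = coeff e p • monomial e 1 := by
    simp [smul_monomial]
  rw [this]
  exact Submodule.smul_mem _ _ (hmon _ e rfl)

/-- Polynomials whose leading monomials are pairwise coprime form a regular sequence, in any
order. -/
theorem mem_span_image_of_mul_mem_of_disjoint_leading (hm : ∀ a, m a ≠ 0)
    (hd : Pairwise fun a b => Disjoint (m a).support (m b).support)
    (hf : ∀ a, LeadsWith w (f a) (m a)) {S : Set A} {a : A} (ha : a ∉ S) {h : MvPolynomial σ R}
    (hh : f a * h ∈ Ideal.span (f '' S)) : h ∈ Ideal.span (f '' S) := by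
  classical
  set M : Ideal (MvPolynomial σ R) :=
    Ideal.span ((fun s => monomial s (1 : R)) '' (m '' S)) with hM
  have hmap : ∀ g ∈ M, substLeading m f g ∈ Ideal.span (f '' S) := by
    suffices ∀ g ∈ M, ∀ r, substLeading m f (r * g) ∈ Ideal.span (f '' S) from
      fun g hg => by simpa using this g hg 1
    intro g hg
    refine Submodule.span_induction ?_ ?_ ?_ ?_ hg
    · rintro _ ⟨_, ⟨b, hb, rfl⟩, rfl⟩ r
      rw [mul_comm, substLeading_mul hm hd]
      exact Ideal.mul_mem_right _ _ (Ideal.subset_span ⟨b, hb, rfl⟩)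
    · simp
    · intro x y _ _ hx hy r
      rw [mul_add, map_add]
      exact add_mem (hx r) (hy r)
    · intro c x _ hx r
      rw [smul_eq_mul, ← mul_assoc]
      exact hx _
  have hlift : ∀ g ∈ Ideal.span (f '' S), ∃ g' ∈ M, substLeading m f g' = g := by
    suffices ∀ g ∈ Ideal.span (f '' S), ∀ r, ∃ g' ∈ M, substLeading m f g' = r * g from
      fun g hg => by simpa using this g hg 1
    intro g hg
    refine Submodule.span_induction ?_ ?_ ?_ ?_ hg
    · rintro _ ⟨b, hb, rfl⟩ r
      obtain ⟨r', rfl⟩ := substLeading_surjective hd hf r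
      refine ⟨monomial (m b) 1 * r', Ideal.mul_mem_right _ _
        (Ideal.subset_span ⟨m b, ⟨b, hb, rfl⟩, rfl⟩), ?_⟩
      rw [substLeading_mul hm hd, mul_comm]
    · exact fun r => ⟨0, M.zero_mem, by simp⟩
    · intro x y _ _ hx hy r
      obtain ⟨x', hx', hx''⟩ := hx r
      obtain ⟨y', hy', hy''⟩ := hy r
      exact ⟨x' + y', add_mem hx' hy', by rw [map_add, hx'', hy'', mul_add]⟩
    · intro c x _ hx r
      rw [smul_eq_mul, ← mul_assoc]
      exact hx _
  obtain ⟨g, rfl⟩ := substLeading_surjective hd hf h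
  obtain ⟨g', hg', hgg'⟩ := hlift _ hh
  rw [← substLeading_mul hm hd] at hgg'
  obtain rfl := substLeading_injective hd hf hgg'
  refine hmap g (mem_ideal_span_monomial_image.2 fun e he => ?_)
  obtain ⟨_, ⟨b, hb, rfl⟩, hle⟩ := mem_ideal_span_monomial_image.1 hg' (m a + e) <| by
    rw [mem_support_iff, coeff_monomial_mul, one_mul]
    exact mem_support_iff.1 he
  refine ⟨m b, ⟨b, hb, rfl⟩, fun i => ?_⟩
  by_cases hi : m b i = 0
  · simp [hi]
  · have : m a i = 0 := Finsupp.notMem_support_iff.1 <|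
      Finset.disjoint_left.1 (hd fun h : b = a => ha (h ▸ hb)) (Finsupp.mem_support_iff.2 hi)
    simpa [this] using hle i

end LeadingMonomials

section RegularSequence

variable {p n : ℕ}

/-- The linear form `x_{p+1,1} + ε x_{p+2,1}` in the first column; it is isotropic when
`ε ^ 2 = -1`. -/
noncomputable def isotropicForm (p n : ℕ) (ε : ℂ) :
    MvPolynomial (Fin (p + 2) × Fin (n + 1)) ℂ :=
  X ((Fin.last p).castSucc, 0) + C ε * X (Fin.last (p + 1), 0)

/-- A weight for which the leading term of `q_{i,j}` is `x_{i+j,i} x_{i+j,j}`. -/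
def nullConeWeight (p n : ℕ) (s : Fin (p + 2) × Fin (n + 1)) : ℕ :=
  (((p + 2 * n + 1 : ℕ) : ℤ) ^ 2 - ((s.1 : ℕ) - 2 * (s.2 : ℕ) : ℤ) ^ 2).toNat

lemma nullConeWeight_cast (s : Fin (p + 2) × Fin (n + 1)) :
    (nullConeWeight p n s : ℤ) =
      ((p + 2 * n + 1 : ℕ) : ℤ) ^ 2 - ((s.1 : ℕ) - 2 * (s.2 : ℕ) : ℤ) ^ 2 := by
  refine Int.toNat_of_nonneg (sub_nonneg.2 (sq_le_sq' ?_ ?_)) <;>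
  · have := s.1.isLt
    have := s.2.isLt
    push_cast
    omega

/-- Indices for the generators `q_{i,j}` and two further linear forms. -/
abbrev NullConeIndex (n : ℕ) : Type := {s : Fin (n + 1) × Fin (n + 1) // s.1 ≤ s.2} ⊕ Bool

/-- The row `i + j`, supporting the leading term of `q_{i,j}`. -/
def leadingRow (h : 2 * n < p) (i j : Fin (n + 1)) : Fin (p + 2) :=
  ⟨i + j, by omega⟩

/-- The exponents of the leading terms. -/
noncomputable def leadingExponent (h : 2 * n < p) :
    NullConeIndex n → (Fin (p + 2) × Fin (n + 1)) →₀ ℕ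
  | .inl s => Finsupp.single (leadingRow h s.1.1 s.1.2, s.1.1) 1 +
      Finsupp.single (leadingRow h s.1.1 s.1.2, s.1.2) 1
  | .inr false => Finsupp.single ((Fin.last p).castSucc, 0) 1
  | .inr true => Finsupp.single (Fin.last (p + 1), 0) 1

/-- The generators `q_{i,j}`, an isotropic linear form and a coordinate. -/
noncomputable def nullConeSequence (p n : ℕ) (ε : ℂ) :
    NullConeIndex n → MvPolynomial (Fin (p + 2) × Fin (n + 1)) ℂ
  | .inl s => ∑ k, X (k, s.1.1) * X (k, s.1.2)
  | .inr false => isotropicForm p n ε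
  | .inr true => X (Fin.last (p + 1), 0)

lemma leadingExponent_ne_zero (h : 2 * n < p) (a : NullConeIndex n) :
    leadingExponent h a ≠ 0 := by
  rcases a with s | _ | _ <;> simp [leadingExponent]

lemma mem_support_leadingExponent_inl (h : 2 * n < p)
    {s : {s : Fin (n + 1) × Fin (n + 1) // s.1 ≤ s.2}}
    {t : Fin (p + 2) × Fin (n + 1)} (ht : t ∈ (leadingExponent h (.inl s)).support) :
    (t.1 : ℕ) = s.1.1 + s.1.2 ∧ ((t.2 : ℕ) = s.1.1 ∨ (t.2 : ℕ) = s.1.2) := by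
  obtain ⟨k, l⟩ := t
  simp only [leadingExponent, Finsupp.mem_support_iff, Finsupp.add_apply,
    Finsupp.single_apply, Prod.mk.injEq, leadingRow, Fin.ext_iff] at ht
  change (k : ℕ) = _ ∧ ((l : ℕ) = _ ∨ (l : ℕ) = _)
  split_ifs at ht <;> omega

lemma mem_support_leadingExponent_inr (h : 2 * n < p) {b : Bool}
    {t : Fin (p + 2) × Fin (n + 1)} (ht : t ∈ (leadingExponent h (.inr b)).support) :
    (t.1 : ℕ) = p + b.toNat := by
  cases b <;> simp [leadingExponent] at ht <;> simp [ht]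

lemma leadingExponent_disjoint (h : 2 * n < p) :
    Pairwise fun a b => Disjoint (leadingExponent h a).support (leadingExponent h b).support := by
  intro a b hab
  rw [Finset.disjoint_left]
  intro t ha hb
  apply hab
  rcases a with ⟨⟨i, j⟩, hij⟩ | a <;> rcases b with ⟨⟨i', j'⟩, hij'⟩ | b
  · have h1 := mem_support_leadingExponent_inl h ha
    have h2 := mem_support_leadingExponent_inl h hb
    simp only [Fin.le_def] at h1 h2 hij hij'
    simp only [Sum.inl.injEq, Subtype.mk.injEq, Prod.mk.injEq, Fin.ext_iff]
    omega
  · have h1 := mem_support_leadingExponent_inl h ha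
    have h2 := mem_support_leadingExponent_inr h hb
    simp only at h1
    omega
  · have h1 := mem_support_leadingExponent_inr h ha
    have h2 := mem_support_leadingExponent_inl h hb
    simp only at h2
    omega
  · have h1 := mem_support_leadingExponent_inr h ha
    have h2 := mem_support_leadingExponent_inr h hb
    cases a <;> cases b <;> simp at h1 h2 ⊢ <;> omega

lemma nullConeSequence_leadsWith (h : 2 * n < p) (ε : ℂ) (a : NullConeIndex n) :
    LeadsWith (nullConeWeight p n) (nullConeSequence p n ε a) (leadingExponent h a) := by
  classical
  rcases a with ⟨⟨i, j⟩, hij⟩ | _ | _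
  · intro e he
    have hsub : nullConeSequence p n ε (.inl ⟨(i, j), hij⟩) -
        monomial (leadingExponent h (.inl ⟨(i, j), hij⟩)) 1 =
        ∑ k ∈ Finset.univ.erase (leadingRow h i j),
          monomial (Finsupp.single (k, i) 1 + Finsupp.single (k, j) 1) (1 : ℂ) := by
      rw [sub_eq_iff_eq_add, leadingExponent, Finset.sum_erase_add _ _ (Finset.mem_univ _)]
      simp [nullConeSequence, X, monomial_mul]
    rw [hsub, mem_support_iff, coeff_sum] at he
    obtain ⟨k, hk, hk'⟩ := Finset.exists_ne_zero_of_sum_ne_zero he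
    obtain rfl : Finsupp.single (k, i) 1 + Finsupp.single (k, j) 1 = e := by
      by_contra hne
      simp [coeff_monomial, hne] at hk'
    have hkr : (k : ℕ) ≠ i + j := fun hk' => Finset.ne_of_mem_erase hk (Fin.ext hk')
    simp only [leadingExponent, map_add, Finsupp.weight_single, one_smul]
    zify
    simp only [nullConeWeight_cast, leadingRow]
    have hpos : (0 : ℤ) < ((k : ℤ) - (i + j)) ^ 2 :=
      sq_pos_of_ne_zero (by omega)
    push_cast
    nlinarith
  · intro e he
    have hsub : nullConeSequence p n ε (.inr false) - monomial (leadingExponent h (.inr false)) 1 =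
        C ε * X (Fin.last (p + 1), 0) := by
      simp [nullConeSequence, isotropicForm, leadingExponent, X]
    rw [hsub, C_mul_X_eq_monomial] at he
    obtain rfl : e = Finsupp.single (Fin.last (p + 1), 0) 1 := by
      simpa using support_monomial_subset he
    simp only [leadingExponent, Finsupp.weight_single, one_smul]
    zify
    simp only [nullConeWeight_cast, Fin.val_last, Fin.val_castSucc, Fin.val_zero]
    push_cast
    nlinarith
  · exact LeadsWith.monomial _ _

lemma nullConeIdealO_eq_span_image (p n : ℕ) (ε : ℂ) :
    nullConeIdealO (p + 2) (n + 1) =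
      Ideal.span (nullConeSequence p n ε '' Set.range Sum.inl) := by
  unfold nullConeIdealO
  congr 1
  ext f
  constructor
  · rintro ⟨i, j, hij, rfl⟩
    exact ⟨_, ⟨⟨(i, j), hij⟩, rfl⟩, rfl⟩
  · rintro ⟨_, ⟨⟨⟨i, j⟩, hij⟩, rfl⟩, rfl⟩
    exact ⟨i, j, hij, rfl⟩

lemma mem_nullConeIdealO_of_isotropicForm_mul_mem (h : 2 * n < p) (ε : ℂ)
    {f : MvPolynomial (Fin (p + 2) × Fin (n + 1)) ℂ}
    (hf : isotropicForm p n ε * f ∈ nullConeIdealO (p + 2) (n + 1)) :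
    f ∈ nullConeIdealO (p + 2) (n + 1) := by
  rw [nullConeIdealO_eq_span_image p n ε] at hf ⊢
  exact mem_span_image_of_mul_mem_of_disjoint_leading (a := .inr false)
    (leadingExponent_ne_zero h) (leadingExponent_disjoint h) (nullConeSequence_leadsWith h ε)
    (by simp) hf

lemma mem_nullConeIdealO_sup_of_X_mul_mem (h : 2 * n < p) (ε : ℂ)
    {f : MvPolynomial (Fin (p + 2) × Fin (n + 1)) ℂ}
    (hf : X (Fin.last (p + 1), 0) * f ∈
      nullConeIdealO (p + 2) (n + 1) ⊔ Ideal.span {isotropicForm p n ε}) :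
    f ∈ nullConeIdealO (p + 2) (n + 1) ⊔ Ideal.span {isotropicForm p n ε} := by
  have hspan : nullConeIdealO (p + 2) (n + 1) ⊔ Ideal.span {isotropicForm p n ε} =
      Ideal.span (nullConeSequence p n ε '' (Set.range Sum.inl ∪ {.inr false})) := by
    rw [nullConeIdealO_eq_span_image p n ε, Set.image_union, Ideal.span_union, Set.image_singleton,
      nullConeSequence]
  rw [hspan] at hf ⊢
  exact mem_span_image_of_mul_mem_of_disjoint_leading (a := .inr true)
    (leadingExponent_ne_zero h) (leadingExponent_disjoint h) (nullConeSequence_leadsWith h ε)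
    (by simp) hf

end RegularSequence

section Gluing

variable {R : Type*} [CommRing R]

lemma isIntegrallyClosed_localizationAway [IsDomain R] [IsIntegrallyClosed R] {x : R}
    (hx : x ≠ 0) : IsIntegrallyClosed (Localization.Away x) :=
  isIntegrallyClosed_of_isLocalization _ (Submonoid.powers x)
    (powers_le_nonZeroDivisors_of_noZeroDivisors hx)

lemma isDomain_of_isDomain_localizationAway (x : R) (hx : ∀ r, x * r = 0 → r = 0)
    [IsDomain (Localization.Away x)] : IsDomain R := by
  have hle : Submonoid.powers x ≤ nonZeroDivisors R := by
    rw [Submonoid.powers_le, mem_nonZeroDivisors_iff_right]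
    intro r hr
    exact hx r (by rwa [mul_comm])
  exact (IsLocalization.injective (Localization.Away x) hle).isDomain
    (algebraMap R (Localization.Away x))

lemma exists_pow_mul_eq_of_isIntegral [IsDomain R] (K : Type*) [Field K] [Algebra R K]
    [IsFractionRing R K] {x : R} (hx : x ≠ 0) [IsIntegrallyClosed (Localization.Away x)]
    {f : K} (hf : IsIntegral R f) :
    ∃ (k : ℕ) (a : R), algebraMap R K x ^ k * f = algebraMap R K a := by
  have hle : Submonoid.powers x ≤ nonZeroDivisors R :=
    powers_le_nonZeroDivisors_of_noZeroDivisors hx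
  let g : Localization.Away x →+* K := IsLocalization.map K (T := nonZeroDivisors R)
    (RingHom.id R) hle
  algebraize [g]
  have : IsScalarTower R (Localization.Away x) K := IsScalarTower.of_algebraMap_eq' (by
    exact ((IsLocalization.map_comp hle).trans (RingHom.comp_id _)).symm)
  have := IsFractionRing.isFractionRing_of_isDomain_of_isLocalization (Submonoid.powers x)
    (Localization.Away x) K
  have : IsDomain (Localization.Away x) := IsLocalization.isDomain_localization hle
  obtain ⟨y, rfl⟩ := (IsIntegrallyClosed.isIntegral_iff (R := Localization.Away x)).1
    (hf.tower_top (A := Localization.Away x))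
  obtain ⟨k, a, ha⟩ := IsLocalization.Away.surj x y
  refine ⟨k, a, ?_⟩
  rw [IsScalarTower.algebraMap_apply R (Localization.Away x) K x,
    IsScalarTower.algebraMap_apply R (Localization.Away x) K a, ← ha, map_mul, map_pow, mul_comm]

/-- A ring with a regular sequence `x, y` is a normal domain as soon as its localizations away
from `x` and from `y` are. -/
theorem isDomain_and_isIntegrallyClosed_of_away (x y : R) (hx : ∀ r, x * r = 0 → r = 0)
    (hxy : ∀ r, x ∣ y * r → x ∣ r)
    [IsDomain (Localization.Away x)] [IsIntegrallyClosed (Localization.Away x)]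
    [IsDomain (Localization.Away y)] [IsIntegrallyClosed (Localization.Away y)] :
    IsDomain R ∧ IsIntegrallyClosed R := by
  have : IsDomain R := isDomain_of_isDomain_localizationAway x hx
  refine ⟨this, ?_⟩
  have hx0 : x ≠ 0 := by
    rintro rfl
    exact one_ne_zero (hx 1 (zero_mul _))
  have hy0 : y ≠ 0 := by
    rintro rfl
    have h : IsUnit (0 : Localization.Away (0 : R)) := by
      simpa using IsLocalization.Away.algebraMap_isUnit (S := Localization.Away (0 : R)) (0 : R)
    exact not_isUnit_zero h
  have hyl : ∀ (l : ℕ) r, x ∣ y ^ l * r → x ∣ r := by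
    intro l
    induction l with
    | zero => simp
    | succ l ih =>
      intro r hr
      rw [pow_succ, mul_assoc] at hr
      exact hxy _ (ih _ hr)
  have hdvd : ∀ (k l : ℕ) a, x ^ k ∣ y ^ l * a → x ^ k ∣ a := by
    intro k l
    induction k with
    | zero => simp
    | succ k ih =>
      intro a ha
      obtain ⟨a', rfl⟩ := hyl l a ((dvd_pow_self x k.succ_ne_zero).trans ha)
      rw [pow_succ', mul_left_comm] at ha
      rw [pow_succ']
      exact mul_dvd_mul_left x (ih a' ((mul_dvd_mul_iff_left hx0).1 ha))
  let K := FractionRing R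
  rw [isIntegrallyClosed_iff K]
  intro f hf
  have hinj := IsFractionRing.injective R K
  obtain ⟨k, a, ha⟩ := exists_pow_mul_eq_of_isIntegral K hx0 hf
  obtain ⟨l, b, hb⟩ := exists_pow_mul_eq_of_isIntegral K hy0 hf
  have hab : y ^ l * a = x ^ k * b := hinj <| by
    simp only [map_mul, map_pow, ← ha, ← hb]; ring
  obtain ⟨c, rfl⟩ := hdvd k l a ⟨b, hab⟩
  refine ⟨c, ?_⟩
  rw [map_mul, map_pow] at ha
  exact (mul_left_cancel₀ (pow_ne_zero k ((map_ne_zero_iff _ hinj).2 hx0)) ha).symm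

lemma MvPolynomial.isIntegrallyClosed_fin [IsDomain R] [IsIntegrallyClosed R] (m : ℕ) :
    IsIntegrallyClosed (MvPolynomial (Fin m) R) := by
  induction m with
  | zero => exact .of_equiv (isEmptyRingEquiv R (Fin 0)).symm
  | succ m ih => exact .of_equiv (finSuccEquiv R m).symm.toRingEquiv

lemma MvPolynomial.isIntegrallyClosed_of_finite [IsDomain R] [IsIntegrallyClosed R]
    (ι : Type*) [Finite ι] : IsIntegrallyClosed (MvPolynomial ι R) := by
  cases nonempty_fintype ι
  have := isIntegrallyClosed_fin (R := R) (Fintype.card ι)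
  exact .of_equiv (renameEquiv R (Fintype.equivFin ι)).symm.toRingEquiv

end Gluing

section Localization

variable {K : Type*} [CommRing K] [Algebra ℂ K] {p n : ℕ}

/-- The null cone coordinate ring. -/
abbrev NullConeRing (p n : ℕ) : Type := MvPolynomial (Fin p × Fin n) ℂ ⧸ nullConeIdealO p n

/-- A matrix `A` with `AᵀA = 0` gives a point of the null cone. -/
noncomputable def NullConeRing.lift (A : Fin p → Fin n → K)
    (hA : ∀ i j, ∑ k, A k i * A k j = 0) : NullConeRing p n →ₐ[ℂ] K :=
  Ideal.Quotient.liftₐ _ (aeval fun s => A s.1 s.2) <| by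
    suffices nullConeIdealO p n ≤ RingHom.ker (aeval (R := ℂ) fun s => A s.1 s.2) from
      fun a ha => this ha
    refine Ideal.span_le.2 ?_
    rintro _ ⟨i, j, -, rfl⟩
    simp [RingHom.mem_ker, hA]

/-- The tautological matrix over the null cone ring. -/
noncomputable def NullConeRing.gen (p n : ℕ) (k : Fin p) (i : Fin n) : NullConeRing p n :=
  Ideal.Quotient.mk _ (X (k, i))

lemma NullConeRing.lift_gen (A : Fin p → Fin n → K) (hA : ∀ i j, ∑ k, A k i * A k j = 0)
    (k : Fin p) (i : Fin n) : NullConeRing.lift A hA (NullConeRing.gen p n k i) = A k i := by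
  simp only [NullConeRing.lift, NullConeRing.gen]
  erw [Ideal.Quotient.lift_mk]
  simp

lemma NullConeRing.sum_gen_mul_gen (i j : Fin n) :
    ∑ k, NullConeRing.gen p n k i * NullConeRing.gen p n k j = 0 := by
  wlog hij : i ≤ j generalizing i j
  · simpa only [mul_comm] using this j i (le_of_not_ge hij)
  simp only [NullConeRing.gen, ← map_mul, ← map_sum]
  exact Ideal.Quotient.eq_zero_iff_mem.2 (Ideal.subset_span ⟨i, j, hij, rfl⟩)

lemma NullConeRing.algHom_ext {f g : NullConeRing p n →ₐ[ℂ] K}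
    (h : ∀ k i, f (NullConeRing.gen p n k i) = g (NullConeRing.gen p n k i)) : f = g :=
  Ideal.Quotient.algHom_ext _ (MvPolynomial.algHom_ext fun s => h s.1 s.2)

/-- The matrix with rows `y`, followed by two rows with isotropic coordinates `w` and `v`. -/
noncomputable def appendIsotropic (ε : ℂ) (y : Fin p → Fin n → K) (w v : Fin n → K) :
    Fin (p + 2) → Fin n → K :=
  Fin.snoc (α := fun _ => Fin n → K) (Fin.snoc (α := fun _ => Fin n → K) y
    fun i => algebraMap ℂ K (1 / 2) * (w i + v i))
    fun i => algebraMap ℂ K (-ε / 2) * (w i - v i)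

/-- Parametrization of the null cone away from `w 0 = 0`, where `t` is the inverse of `w 0`:
the rows other than the last two. -/
def chartRow (t : K) (z : Fin p → K) (w : Fin (n + 1) → K) (Y : Fin p → Fin n → K)
    (k : Fin p) (i : Fin (n + 1)) : K :=
  Fin.cons (α := fun _ => K) 0 (Y k) i + w i * t * z k

/-- Parametrization of the null cone away from `w 0 = 0`, where `t` is the inverse of `w 0`:
the second isotropic coordinate. -/
def chartDual (t : K) (z : Fin p → K) (w : Fin (n + 1) → K) (Y : Fin p → Fin n → K)
    (i : Fin (n + 1)) : K :=
  -2 * t * ∑ k, z k * Fin.cons (α := fun _ => K) 0 (Y k) i - w i * t ^ 2 * ∑ k, z k * z k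

lemma sum_appendIsotropic {ε : ℂ} (hε : ε ^ 2 = -1) (y : Fin p → Fin n → K) (w v : Fin n → K)
    (i j : Fin n) :
    ∑ k, appendIsotropic ε y w v k i * appendIsotropic ε y w v k j =
      ∑ k, y k i * y k j + algebraMap ℂ K (1 / 2) * (w i * v j + v i * w j) := by
  simp only [appendIsotropic, Fin.sum_univ_castSucc, Fin.snoc_castSucc, Fin.snoc_last]
  have h1 : algebraMap ℂ K (-ε / 2) * algebraMap ℂ K (-ε / 2) =
      - (algebraMap ℂ K (1 / 2) * algebraMap ℂ K (1 / 2)) := by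
    rw [← map_mul, ← map_mul, ← map_neg]
    congr 1
    linear_combination hε / 4
  have h2 : algebraMap ℂ K (1 / 2) * 2 = 1 := by
    rw [← map_ofNat (algebraMap ℂ K) 2, ← map_mul]; norm_num
  linear_combination (w i - v i) * (w j - v j) * h1 +
    algebraMap ℂ K (1 / 2) * (w i * v j + v i * w j) * h2

lemma sum_chart {ε : ℂ} (hε : ε ^ 2 = -1) (t : K) (z : Fin p → K)
    (w : Fin (n + 1) → K) (Y : Fin p → Fin n → K) (hY : ∀ i j, ∑ k, Y k i * Y k j = 0)
    (i j : Fin (n + 1)) :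
    ∑ k, appendIsotropic ε (chartRow t z w Y) w (chartDual t z w Y) k i *
      appendIsotropic ε (chartRow t z w Y) w (chartDual t z w Y) k j = 0 := by
  rw [sum_appendIsotropic hε]
  have h2 : algebraMap ℂ K (1 / 2) * 2 = 1 := by
    rw [← map_ofNat (algebraMap ℂ K) 2, ← map_mul]; norm_num
  set Y' : Fin p → Fin (n + 1) → K := fun k => Fin.cons (α := fun _ => K) 0 (Y k) with hY'
  have h0 : ∑ k, Y' k i * Y' k j = 0 := by
    refine Fin.cases ?_ (fun i => ?_) i
    · simp [hY']
    · refine Fin.cases ?_ (fun j => ?_) j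
      · simp [hY']
      · simpa [hY'] using hY i j
  have hrow : ∑ k, chartRow t z w Y k i * chartRow t z w Y k j =
      ∑ k, Y' k i * Y' k j + w j * t * ∑ k, z k * Y' k i + w i * t * ∑ k, z k * Y' k j +
        w i * w j * t ^ 2 * ∑ k, z k * z k := by
    simp only [Finset.mul_sum, ← Finset.sum_add_distrib]
    refine Finset.sum_congr rfl fun k _ => ?_
    simp only [chartRow, hY']
    ring
  have hdual (i) : chartDual t z w Y i =
    -2 * t * ∑ k, z k * Y' k i - w i * t ^ 2 * ∑ k, z k * z k := rfl
  rw [hrow, h0, hdual, hdual]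
  linear_combination (- (w j * t * ∑ k, z k * Y' k i) - w i * t * ∑ k, z k * Y' k j -
    w i * w j * t ^ 2 * ∑ k, z k * z k) * h2

/-- The first isotropic coordinates of the last two rows of a matrix. -/
noncomputable def isotropicCoord (ε : ℂ) (A : Fin (p + 2) → Fin n → K) (i : Fin n) : K :=
  A (Fin.last p).castSucc i + algebraMap ℂ K ε * A (Fin.last (p + 1)) i

/-- The second isotropic coordinates of the last two rows of a matrix. -/
noncomputable def isotropicDual (ε : ℂ) (A : Fin (p + 2) → Fin n → K) (i : Fin n) : K :=
  A (Fin.last p).castSucc i - algebraMap ℂ K ε * A (Fin.last (p + 1)) i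

/-- Clearing the isotropic coordinates of all columns but the first, where `t` is the inverse of
the isotropic coordinate of the first column. -/
noncomputable def reducedMatrix (ε : ℂ) (t : K) (A : Fin (p + 2) → Fin (n + 1) → K)
    (k : Fin p) (j : Fin n) : K :=
  A k.castSucc.castSucc j.succ - isotropicCoord ε A j.succ * t * A k.castSucc.castSucc 0

lemma isotropicCoord_appendIsotropic {ε : ℂ} (hε : ε ^ 2 = -1) (y : Fin p → Fin n → K)
    (w v : Fin n → K) (i : Fin n) : isotropicCoord ε (appendIsotropic ε y w v) i = w i := by
  simp only [isotropicCoord, appendIsotropic, Fin.snoc_castSucc, Fin.snoc_last]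
  have h1 : algebraMap ℂ K ε * algebraMap ℂ K (-ε / 2) = algebraMap ℂ K (1 / 2) := by
    rw [← map_mul]
    congr 1
    linear_combination -hε / 2
  have h2 : algebraMap ℂ K (1 / 2) * 2 = 1 := by
    rw [← map_ofNat (algebraMap ℂ K) 2, ← map_mul]; norm_num
  linear_combination (w i - v i) * h1 + w i * h2

lemma reducedMatrix_appendIsotropic {ε : ℂ} (hε : ε ^ 2 = -1) (t : K) (z : Fin p → K)
    (w : Fin (n + 1) → K) (hw : w 0 * t = 1) (Y : Fin p → Fin n → K) (v : Fin (n + 1) → K)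
    (k : Fin p) (j : Fin n) :
    reducedMatrix ε t (appendIsotropic ε (chartRow t z w Y) w v) k j = Y k j := by
  rw [reducedMatrix, isotropicCoord_appendIsotropic hε]
  simp only [appendIsotropic, Fin.snoc_castSucc, chartRow, Fin.cons_succ, Fin.cons_zero]
  linear_combination (- w j.succ * t * z k) * hw

lemma sum_castSucc_mul_eq {ε : ℂ} (hε : ε ^ 2 = -1) (A : Fin (p + 2) → Fin n → K)
    (hA : ∀ i j, ∑ k, A k i * A k j = 0) (i j : Fin n) :
    2 * ∑ k : Fin p, A k.castSucc.castSucc i * A k.castSucc.castSucc j =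
      - (isotropicCoord ε A i * isotropicDual ε A j + isotropicDual ε A i * isotropicCoord ε A j)
      := by
  have h := hA i j
  simp only [Fin.sum_univ_castSucc] at h
  have h1 : algebraMap ℂ K ε ^ 2 = -1 := by rw [← map_pow, hε, map_neg, map_one]
  simp only [isotropicCoord, isotropicDual]
  linear_combination 2 * h - 2 * A (Fin.last (p + 1)) i * A (Fin.last (p + 1)) j * h1

lemma sum_reducedMatrix {ε : ℂ} (hε : ε ^ 2 = -1) (A : Fin (p + 2) → Fin (n + 1) → K)
    (hA : ∀ i j, ∑ k, A k i * A k j = 0) {t : K} (ht : isotropicCoord ε A 0 * t = 1)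
    (i j : Fin n) : ∑ k, reducedMatrix ε t A k i * reducedMatrix ε t A k j = 0 := by
  have h2 : algebraMap ℂ K (1 / 2) * 2 = 1 := by
    rw [← map_ofNat (algebraMap ℂ K) 2, ← map_mul]; norm_num
  have hsum : ∑ k, reducedMatrix ε t A k i * reducedMatrix ε t A k j =
      ∑ k : Fin p, A k.castSucc.castSucc i.succ * A k.castSucc.castSucc j.succ -
      isotropicCoord ε A j.succ * t *
        ∑ k : Fin p, A k.castSucc.castSucc 0 * A k.castSucc.castSucc i.succ -
      isotropicCoord ε A i.succ * t *
        ∑ k : Fin p, A k.castSucc.castSucc 0 * A k.castSucc.castSucc j.succ +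
      isotropicCoord ε A i.succ * isotropicCoord ε A j.succ * t ^ 2 *
        ∑ k : Fin p, A k.castSucc.castSucc 0 * A k.castSucc.castSucc 0 := by
    simp only [Finset.mul_sum, ← Finset.sum_add_distrib, ← Finset.sum_sub_distrib]
    refine Finset.sum_congr rfl fun k _ => ?_
    simp only [reducedMatrix]
    ring
  suffices 2 * ∑ k, reducedMatrix ε t A k i * reducedMatrix ε t A k j = 0 by
    linear_combination algebraMap ℂ K (1 / 2) * this -
      (∑ k, reducedMatrix ε t A k i * reducedMatrix ε t A k j) * h2
  rw [hsum]
  set w := isotropicCoord ε A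
  set v := isotropicDual ε A
  linear_combination sum_castSucc_mul_eq hε A hA i.succ j.succ -
    w j.succ * t * sum_castSucc_mul_eq hε A hA 0 i.succ -
    w i.succ * t * sum_castSucc_mul_eq hε A hA 0 j.succ +
    w i.succ * w j.succ * t ^ 2 * sum_castSucc_mul_eq hε A hA 0 0 +
    (w j.succ * v i.succ + w i.succ * v j.succ - 2 * w i.succ * w j.succ * t * v 0) * ht

lemma appendIsotropic_chart {ε : ℂ} (hε : ε ^ 2 = -1) (A : Fin (p + 2) → Fin (n + 1) → K)
    (hA : ∀ i j, ∑ k, A k i * A k j = 0) {t : K} (ht : isotropicCoord ε A 0 * t = 1) :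
    appendIsotropic ε (chartRow t (fun k => A k.castSucc.castSucc 0) (isotropicCoord ε A)
      (reducedMatrix ε t A)) (isotropicCoord ε A) (chartDual t (fun k => A k.castSucc.castSucc 0)
      (isotropicCoord ε A) (reducedMatrix ε t A)) = A := by
  have h2 : algebraMap ℂ K (1 / 2) * 2 = 1 := by
    rw [← map_ofNat (algebraMap ℂ K) 2, ← map_mul]; norm_num
  have h1 : algebraMap ℂ K (-ε / 2) * algebraMap ℂ K ε = algebraMap ℂ K (1 / 2) := by
    rw [← map_mul]
    congr 1
    linear_combination -hε / 2
  have hcons (k : Fin p) (i : Fin (n + 1)) :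
      Fin.cons (α := fun _ => K) 0 (reducedMatrix ε t A k) i =
        A k.castSucc.castSucc i - isotropicCoord ε A i * t * A k.castSucc.castSucc 0 := by
    refine Fin.cases ?_ (fun i => ?_) i
    · simp [ht]
    · simp [reducedMatrix]
  have hdual (i : Fin (n + 1)) : chartDual t (fun k => A k.castSucc.castSucc 0)
      (isotropicCoord ε A) (reducedMatrix ε t A) i = isotropicDual ε A i := by
    have hsum : ∑ k : Fin p, A k.castSucc.castSucc 0 *
        (A k.castSucc.castSucc i - isotropicCoord ε A i * t * A k.castSucc.castSucc 0) =
        ∑ k : Fin p, A k.castSucc.castSucc 0 * A k.castSucc.castSucc i -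
        isotropicCoord ε A i * t *
          ∑ k : Fin p, A k.castSucc.castSucc 0 * A k.castSucc.castSucc 0 := by
      simp only [Finset.mul_sum, ← Finset.sum_sub_distrib]
      exact Finset.sum_congr rfl fun k _ => by ring
    simp only [chartDual, hcons]
    rw [hsum]
    set w := isotropicCoord ε A
    set v := isotropicDual ε A
    have h00 : ∑ k : Fin p, A k.castSucc.castSucc 0 * A k.castSucc.castSucc 0 = - (w 0 * v 0) := by
      linear_combination algebraMap ℂ K (1 / 2) * sum_castSucc_mul_eq hε A hA 0 0 -
        (∑ k : Fin p, A k.castSucc.castSucc 0 * A k.castSucc.castSucc 0 + w 0 * v 0) * h2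
    rw [h00]
    linear_combination -t * sum_castSucc_mul_eq hε A hA 0 i +
      (v i - w i * t * v 0) * ht
  funext k i
  refine Fin.lastCases ?_ (fun k => ?_) k
  · simp only [appendIsotropic, Fin.snoc_last, hdual]
    simp only [isotropicCoord, isotropicDual]
    linear_combination 2 * A (Fin.last (p + 1)) i * h1 + A (Fin.last (p + 1)) i * h2
  refine Fin.lastCases ?_ (fun k => ?_) k
  · simp only [appendIsotropic, Fin.snoc_last, Fin.snoc_castSucc, hdual]
    simp only [isotropicCoord, isotropicDual]
    linear_combination A (Fin.last p).castSucc i * h2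
  · simp only [appendIsotropic, Fin.snoc_castSucc, chartRow, hcons]
    ring

variable {L : Type*} [CommRing L] [Algebra ℂ L] (φ : K →ₐ[ℂ] L)

lemma map_isotropicCoord (ε : ℂ) (A : Fin (p + 2) → Fin n → K) (i : Fin n) :
    φ (isotropicCoord ε A i) = isotropicCoord ε (fun k j => φ (A k j)) i := by
  simp [isotropicCoord]

lemma map_reducedMatrix (ε : ℂ) (t : K) (A : Fin (p + 2) → Fin (n + 1) → K)
    (k : Fin p) (j : Fin n) :
    φ (reducedMatrix ε t A k j) = reducedMatrix ε (φ t) (fun k j => φ (A k j)) k j := by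
  simp [reducedMatrix, map_isotropicCoord]

lemma map_appendIsotropic (ε : ℂ) (y : Fin p → Fin n → K) (w v : Fin n → K) (k : Fin (p + 2))
    (i : Fin n) : φ (appendIsotropic ε y w v k i) =
      appendIsotropic ε (fun k j => φ (y k j)) (fun j => φ (w j)) (fun j => φ (v j)) k i := by
  refine Fin.lastCases ?_ (fun k => ?_) k
  · simp only [appendIsotropic, Fin.snoc_last, map_mul, map_sub, AlgHom.commutes]
  refine Fin.lastCases ?_ (fun k => ?_) k
  · simp only [appendIsotropic, Fin.snoc_last, Fin.snoc_castSucc, map_mul, map_add,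
      AlgHom.commutes]
  · simp only [appendIsotropic, Fin.snoc_castSucc]

lemma map_cons_zero (Y : Fin n → K) (i : Fin (n + 1)) :
    φ (Fin.cons (α := fun _ => K) 0 Y i) = Fin.cons (α := fun _ => L) 0 (fun j => φ (Y j)) i := by
  refine Fin.cases ?_ (fun i => ?_) i <;> simp

lemma map_chartRow (t : K) (z : Fin p → K) (w : Fin (n + 1) → K) (Y : Fin p → Fin n → K)
    (k : Fin p) (i : Fin (n + 1)) : φ (chartRow t z w Y k i) =
      chartRow (φ t) (fun k => φ (z k)) (fun j => φ (w j)) (fun k j => φ (Y k j)) k i := by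
  simp only [chartRow, map_add, map_mul, map_cons_zero]

lemma map_chartDual (t : K) (z : Fin p → K) (w : Fin (n + 1) → K) (Y : Fin p → Fin n → K)
    (i : Fin (n + 1)) : φ (chartDual t z w Y i) =
      chartDual (φ t) (fun k => φ (z k)) (fun j => φ (w j)) (fun k j => φ (Y k j)) i := by
  simp only [chartDual, map_sub, map_mul, map_cons_zero, map_neg, map_pow, map_ofNat, map_sum]

end Localization

section Chart

variable (p n : ℕ) (ε : ℂ)

/-- The isotropic coordinate of the first column, in the null cone ring. -/
noncomputable abbrev chartCoord : NullConeRing (p + 2) (n + 1) :=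
  isotropicCoord ε (NullConeRing.gen (p + 2) (n + 1)) 0

/-- The null cone ring with the isotropic coordinate of the first column inverted. -/
abbrev ChartSource : Type := Localization.Away (chartCoord p n ε)

/-- A polynomial ring over a smaller null cone ring. -/
abbrev ChartBase : Type := MvPolynomial (Fin p ⊕ Fin (n + 1)) (NullConeRing p n)

/-- A localized polynomial ring over a smaller null cone ring. -/
abbrev ChartTarget : Type := Localization.Away (X (Sum.inr 0) : ChartBase p n)

/-- The tautological matrix over `ChartSource`. -/
noncomputable def chartMatrix (k : Fin (p + 2)) (i : Fin (n + 1)) : ChartSource p n ε :=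
  algebraMap _ _ (NullConeRing.gen (p + 2) (n + 1) k i)

/-- The inverse of the inverted coordinate of `ChartSource`. -/
noncomputable def chartInv : ChartSource p n ε := IsLocalization.Away.invSelf (chartCoord p n ε)

lemma sum_chartMatrix (i j : Fin (n + 1)) :
    ∑ k, chartMatrix p n ε k i * chartMatrix p n ε k j = 0 := by
  simp only [chartMatrix, ← map_mul, ← map_sum, NullConeRing.sum_gen_mul_gen, map_zero]

lemma algebraMap_chartCoord :
    algebraMap _ (ChartSource p n ε) (chartCoord p n ε) =
      isotropicCoord ε (chartMatrix p n ε) 0 :=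
  map_isotropicCoord (Algebra.algHom ℂ (NullConeRing (p + 2) (n + 1)) (ChartSource p n ε)) _ _ _

lemma isotropicCoord_mul_chartInv :
    isotropicCoord ε (chartMatrix p n ε) 0 * chartInv p n ε = 1 := by
  rw [← algebraMap_chartCoord]
  exact IsLocalization.Away.mul_invSelf _

/-- The inverse of the inverted coordinate of `ChartTarget`. -/
noncomputable def targetInv : ChartTarget p n :=
  IsLocalization.Away.invSelf (X (Sum.inr 0) : ChartBase p n)

/-- The free coordinates of `ChartTarget` in the first column. -/
noncomputable def targetColumn (k : Fin p) : ChartTarget p n :=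
  algebraMap (ChartBase p n) _ (X (Sum.inl k))

/-- The free coordinates of `ChartTarget` giving the isotropic coordinates. -/
noncomputable def targetCoord (i : Fin (n + 1)) : ChartTarget p n :=
  algebraMap (ChartBase p n) _ (X (Sum.inr i))

/-- The smaller tautological matrix over `ChartTarget`. -/
noncomputable def targetMatrix (k : Fin p) (j : Fin n) : ChartTarget p n :=
  algebraMap (ChartBase p n) _ (C (NullConeRing.gen p n k j))

lemma sum_targetMatrix (i j : Fin n) :
    ∑ k, targetMatrix p n k i * targetMatrix p n k j = 0 := by
  simp only [targetMatrix, ← map_mul, ← map_sum, NullConeRing.sum_gen_mul_gen, map_zero]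

lemma targetCoord_mul_targetInv : targetCoord p n 0 * targetInv p n = 1 :=
  IsLocalization.Away.mul_invSelf _

/-- The matrix over `ChartTarget` corresponding to the tautological matrix. -/
noncomputable def targetPoint : Fin (p + 2) → Fin (n + 1) → ChartTarget p n :=
  appendIsotropic ε
    (chartRow (targetInv p n) (targetColumn p n) (targetCoord p n) (targetMatrix p n))
    (targetCoord p n)
    (chartDual (targetInv p n) (targetColumn p n) (targetCoord p n) (targetMatrix p n))

variable {ε}

lemma sum_targetPoint (hε : ε ^ 2 = -1) (i j : Fin (n + 1)) :
    ∑ k, targetPoint p n ε k i * targetPoint p n ε k j = 0 :=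
  sum_chart hε _ _ _ _ (sum_targetMatrix p n) i j

/-- The comparison map from `ChartSource` to `ChartTarget`. -/
noncomputable def chartToTarget (hε : ε ^ 2 = -1) : ChartSource p n ε →ₐ[ℂ] ChartTarget p n :=
  IsLocalization.Away.liftAlgHom (chartCoord p n ε)
    (f := NullConeRing.lift (targetPoint p n ε) (sum_targetPoint p n hε)) <| by
    rw [chartCoord, map_isotropicCoord]
    simp only [NullConeRing.lift_gen]
    refine IsUnit.of_mul_eq_one (targetInv p n) ?_
    rw [targetPoint, isotropicCoord_appendIsotropic hε, targetCoord_mul_targetInv]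

lemma chartToTarget_chartMatrix (hε : ε ^ 2 = -1) (k : Fin (p + 2)) (i : Fin (n + 1)) :
    chartToTarget p n hε (chartMatrix p n ε k i) = targetPoint p n ε k i := by
  rw [chartToTarget, chartMatrix, IsLocalization.Away.coe_liftAlgHom]
  exact (IsLocalization.Away.lift_eq _ _ _).trans (NullConeRing.lift_gen _ _ _ _)

lemma chartToTarget_chartInv (hε : ε ^ 2 = -1) :
    chartToTarget p n hε (chartInv p n ε) = targetInv p n := by
  have h1 := congrArg (chartToTarget p n hε) (isotropicCoord_mul_chartInv p n ε)
  rw [map_mul, map_one, map_isotropicCoord] at h1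
  simp only [chartToTarget_chartMatrix] at h1
  rw [targetPoint, isotropicCoord_appendIsotropic hε] at h1
  calc _ = chartToTarget p n hε (chartInv p n ε) * (targetCoord p n 0 * targetInv p n) := by
        rw [targetCoord_mul_targetInv, mul_one]
    _ = _ := by linear_combination targetInv p n * h1

/-- The comparison map from `ChartTarget` to `ChartSource`. -/
noncomputable def targetToChart (hε : ε ^ 2 = -1) : ChartTarget p n →ₐ[ℂ] ChartSource p n ε :=
  IsLocalization.Away.liftAlgHom (X (Sum.inr 0) : ChartBase p n)
    (f := aevalTower (NullConeRing.lift (reducedMatrix ε (chartInv p n ε) (chartMatrix p n ε))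
      (sum_reducedMatrix hε _ (sum_chartMatrix p n ε) (isotropicCoord_mul_chartInv p n ε)))
      (Sum.elim (fun k => chartMatrix p n ε k.castSucc.castSucc 0)
        (isotropicCoord ε (chartMatrix p n ε)))) <| by
    rw [aevalTower_X]
    exact IsUnit.of_mul_eq_one _ (isotropicCoord_mul_chartInv p n ε)

lemma targetToChart_algebraMap (hε : ε ^ 2 = -1) (b : ChartBase p n) :
    targetToChart p n hε (algebraMap _ _ b) =
      aevalTower (NullConeRing.lift (reducedMatrix ε (chartInv p n ε) (chartMatrix p n ε))
      (sum_reducedMatrix hε _ (sum_chartMatrix p n ε) (isotropicCoord_mul_chartInv p n ε)))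
      (Sum.elim (fun k => chartMatrix p n ε k.castSucc.castSucc 0)
        (isotropicCoord ε (chartMatrix p n ε))) b := by
  rw [targetToChart, IsLocalization.Away.coe_liftAlgHom]
  exact IsLocalization.Away.lift_eq _ _ _

lemma targetToChart_targetColumn (hε : ε ^ 2 = -1) (k : Fin p) :
    targetToChart p n hε (targetColumn p n k) = chartMatrix p n ε k.castSucc.castSucc 0 := by
  rw [targetColumn, targetToChart_algebraMap, aevalTower_X, Sum.elim_inl]

lemma targetToChart_targetCoord (hε : ε ^ 2 = -1) (i : Fin (n + 1)) :
    targetToChart p n hε (targetCoord p n i) = isotropicCoord ε (chartMatrix p n ε) i := by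
  rw [targetCoord, targetToChart_algebraMap, aevalTower_X, Sum.elim_inr]

lemma targetToChart_targetMatrix (hε : ε ^ 2 = -1) (k : Fin p) (j : Fin n) :
    targetToChart p n hε (targetMatrix p n k j) =
      reducedMatrix ε (chartInv p n ε) (chartMatrix p n ε) k j := by
  rw [targetMatrix, targetToChart_algebraMap, aevalTower_C, NullConeRing.lift_gen]

lemma targetToChart_targetInv (hε : ε ^ 2 = -1) :
    targetToChart p n hε (targetInv p n) = chartInv p n ε := by
  have h1 := congrArg (targetToChart p n hε) (targetCoord_mul_targetInv p n)
  rw [map_mul, map_one, targetToChart_targetCoord] at h1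
  calc _ = targetToChart p n hε (targetInv p n) *
        (isotropicCoord ε (chartMatrix p n ε) 0 * chartInv p n ε) := by
        rw [isotropicCoord_mul_chartInv, mul_one]
    _ = _ := by linear_combination chartInv p n ε * h1

lemma targetToChart_comp_chartToTarget (hε : ε ^ 2 = -1) :
    (targetToChart p n hε).comp (chartToTarget p n hε) = AlgHom.id ℂ _ := by
  refine IsLocalization.algHom_ext (Submonoid.powers (chartCoord p n ε)) ?_
  refine NullConeRing.algHom_ext fun k i => ?_
  change targetToChart p n hε (chartToTarget p n hε (chartMatrix p n ε k i)) =
    chartMatrix p n ε k i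
  rw [chartToTarget_chartMatrix, targetPoint, map_appendIsotropic]
  simp only [map_chartRow, map_chartDual, targetToChart_targetInv, targetToChart_targetColumn,
    targetToChart_targetCoord, targetToChart_targetMatrix]
  exact congrFun (congrFun (appendIsotropic_chart hε (chartMatrix p n ε) (sum_chartMatrix p n ε)
    (isotropicCoord_mul_chartInv p n ε)) k) i

lemma chartToTarget_comp_targetToChart (hε : ε ^ 2 = -1) :
    (chartToTarget p n hε).comp (targetToChart p n hε) = AlgHom.id ℂ _ := by
  refine IsLocalization.algHom_ext (Submonoid.powers (X (Sum.inr 0) : ChartBase p n)) ?_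
  have hcol (k : Fin p) :
      chartToTarget p n hε (chartMatrix p n ε k.castSucc.castSucc 0) = targetColumn p n k := by
    rw [chartToTarget_chartMatrix, targetPoint]
    simp only [appendIsotropic, Fin.snoc_castSucc, chartRow, Fin.cons_zero]
    linear_combination targetColumn p n k * targetCoord_mul_targetInv p n
  refine MvPolynomial.algHom_ext' ?_ ?_
  · refine NullConeRing.algHom_ext fun k j => ?_
    change chartToTarget p n hε (targetToChart p n hε (targetMatrix p n k j)) =
      targetMatrix p n k j
    rw [targetToChart_targetMatrix, map_reducedMatrix, chartToTarget_chartInv]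
    simp only [chartToTarget_chartMatrix]
    exact reducedMatrix_appendIsotropic hε _ _ _ (targetCoord_mul_targetInv p n) _ _ k j
  · rintro (k | i)
    · change chartToTarget p n hε (targetToChart p n hε (targetColumn p n k)) = targetColumn p n k
      rw [targetToChart_targetColumn, hcol]
    · change chartToTarget p n hε (targetToChart p n hε (targetCoord p n i)) = targetCoord p n i
      rw [targetToChart_targetCoord, map_isotropicCoord]
      simp only [chartToTarget_chartMatrix]
      exact isotropicCoord_appendIsotropic hε _ _ _ i

/-- Away from the isotropic coordinate of a column, the null cone is a product of an affine space
with a smaller null cone. -/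
noncomputable def chartEquiv (hε : ε ^ 2 = -1) : ChartSource p n ε ≃ₐ[ℂ] ChartTarget p n :=
  AlgEquiv.ofAlgHom (chartToTarget p n hε) (targetToChart p n hε)
    (chartToTarget_comp_targetToChart p n hε) (targetToChart_comp_chartToTarget p n hε)

lemma isDomain_chartSource (hε : ε ^ 2 = -1) [IsDomain (NullConeRing p n)] :
    IsDomain (ChartSource p n ε) := by
  have : IsDomain (ChartTarget p n) := IsLocalization.isDomain_localization
    (powers_le_nonZeroDivisors_of_noZeroDivisors (X_ne_zero _))
  exact (chartEquiv p n hε).toMulEquiv.isDomain _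

lemma isIntegrallyClosed_chartTarget [IsDomain (NullConeRing p n)]
    [IsIntegrallyClosed (NullConeRing p n)] : IsIntegrallyClosed (ChartTarget p n) := by
  have : IsIntegrallyClosed (ChartBase p n) := isIntegrallyClosed_of_finite _
  exact isIntegrallyClosed_localizationAway (X_ne_zero _)

lemma isIntegrallyClosed_chartSource (hε : ε ^ 2 = -1) [IsDomain (NullConeRing p n)]
    [IsIntegrallyClosed (NullConeRing p n)] : IsIntegrallyClosed (ChartSource p n ε) := by
  have := isIntegrallyClosed_chartTarget p n
  exact IsIntegrallyClosed.of_equiv (R := ChartTarget p n) (chartEquiv p n hε).symm.toRingEquiv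

end Chart

lemma mk_isotropicForm (p n : ℕ) (ε : ℂ) :
    Ideal.Quotient.mk (nullConeIdealO (p + 2) (n + 1)) (isotropicForm p n ε) =
      chartCoord p n ε := by
  simp only [isotropicForm, chartCoord, isotropicCoord, NullConeRing.gen, map_add, map_mul]
  rfl

lemma chartCoord_mul_eq_zero {p n : ℕ} (h : 2 * n < p) (ε : ℂ)
    (r : NullConeRing (p + 2) (n + 1)) (hr : chartCoord p n ε * r = 0) : r = 0 := by
  obtain ⟨f, rfl⟩ := Ideal.Quotient.mk_surjective r
  rw [← mk_isotropicForm, ← map_mul, Ideal.Quotient.eq_zero_iff_mem] at hr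
  exact Ideal.Quotient.eq_zero_iff_mem.2 (mem_nullConeIdealO_of_isotropicForm_mul_mem h ε hr)

lemma chartCoord_dvd_iff {p n : ℕ} (ε : ℂ) (f : MvPolynomial (Fin (p + 2) × Fin (n + 1)) ℂ) :
    chartCoord p n ε ∣ Ideal.Quotient.mk (nullConeIdealO (p + 2) (n + 1)) f ↔
      f ∈ nullConeIdealO (p + 2) (n + 1) ⊔ Ideal.span {isotropicForm p n ε} := by
  rw [← mk_isotropicForm, ← Ideal.mem_span_singleton, ← Set.image_singleton, ← Ideal.map_span,
    ← Ideal.mem_comap, Ideal.comap_map_of_surjective' _ Ideal.Quotient.mk_surjective,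
    Ideal.mk_ker, sup_comm]

lemma chartCoord_dvd_of_dvd_mul {p n : ℕ} (h : 2 * n < p) {ε : ℂ} (hε : ε ≠ 0)
    (r : NullConeRing (p + 2) (n + 1)) (hr : chartCoord p n ε ∣ chartCoord p n (-ε) * r) :
    chartCoord p n ε ∣ r := by
  obtain ⟨f, rfl⟩ := Ideal.Quotient.mk_surjective r
  rw [← mk_isotropicForm p n (-ε), ← map_mul, chartCoord_dvd_iff] at hr
  rw [chartCoord_dvd_iff]
  apply mem_nullConeIdealO_sup_of_X_mul_mem h ε
  have hX : X (Fin.last (p + 1), 0) * f =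
      C (2 * ε)⁻¹ * (isotropicForm p n ε * f) - C (2 * ε)⁻¹ * (isotropicForm p n (-ε) * f) := by
    have hC : C (2 * ε)⁻¹ * (2 * C ε) = (1 : MvPolynomial (Fin (p + 2) × Fin (n + 1)) ℂ) := by
      rw [← map_ofNat C 2, ← map_mul, ← map_mul, inv_mul_cancel₀ (by simpa using hε), map_one]
    simp only [isotropicForm, map_neg]
    linear_combination - X (Fin.last (p + 1), 0) * f * hC
  rw [hX]
  exact sub_mem (Ideal.mul_mem_left _ _ (Ideal.mul_mem_right _ _
    (Ideal.mem_sup_right (Ideal.mem_span_singleton_self _)))) (Ideal.mul_mem_left _ _ hr)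

/-- In the stable range, the null cone ring is a normal domain. -/
theorem isDomain_and_isIntegrallyClosed_nullConeRing (p n : ℕ) (h : 2 * n < p) :
    IsDomain (NullConeRing p n) ∧ IsIntegrallyClosed (NullConeRing p n) := by
  induction n generalizing p with
  | zero =>
    have hbot : nullConeIdealO p 0 = ⊥ := by
      refine Ideal.span_eq_bot.2 ?_
      rintro _ ⟨i, -⟩
      exact i.elim0
    let e : NullConeRing p 0 ≃+* MvPolynomial (Fin p × Fin 0) ℂ :=
      (Ideal.quotEquivOfEq hbot).trans (RingEquiv.quotientBot _)
    have : IsIntegrallyClosed (MvPolynomial (Fin p × Fin 0) ℂ) := isIntegrallyClosed_of_finite _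
    exact ⟨e.toMulEquiv.isDomain _, .of_equiv e.symm⟩
  | succ n ih =>
    obtain ⟨p, rfl⟩ : ∃ q, p = q + 2 := ⟨p - 2, by omega⟩
    have h' : 2 * n < p := by omega
    obtain ⟨_, _⟩ := ih p h'
    have hI : Complex.I ^ 2 = -1 := Complex.I_sq
    have hI' : (-Complex.I) ^ 2 = -1 := by rw [neg_sq, hI]
    have := isDomain_chartSource p n hI
    have := isDomain_chartSource p n hI'
    have := isIntegrallyClosed_chartSource p n hI
    have := isIntegrallyClosed_chartSource p n hI'
    exact isDomain_and_isIntegrallyClosed_of_away (chartCoord p n Complex.I)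
      (chartCoord p n (-Complex.I)) (chartCoord_mul_eq_zero h' _)
      (chartCoord_dvd_of_dvd_mul h' Complex.I_ne_zero)

/-- In the stable range `2n < p`, the ideal `J⁺` of the null cone
`{A ∈ M_{p,n}(ℂ) : AᵀA = 0}` is prime, and the quotient ring is an integrally
closed integral domain (the null cone is an irreducible normal affine variety). -/
theorem nullConeO_prime_normal (p n : ℕ) (hp : 0 < p) (hn : 0 < n) (h : 2 * n < p) :
    (nullConeIdealO p n).IsPrime ∧
      IsDomain (MvPolynomial (Fin p × Fin n) ℂ ⧸ nullConeIdealO p n) ∧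
      IsIntegrallyClosed (MvPolynomial (Fin p × Fin n) ℂ ⧸ nullConeIdealO p n) := by
  obtain ⟨hdom, hclosed⟩ := isDomain_and_isIntegrallyClosed_nullConeRing p n h
  exact ⟨(Ideal.Quotient.isDomain_iff_prime _).1 hdom, hdom, hclosed⟩
end

section
/- Let p, n be positive integers with 2n < p. In the polynomial ring ℂ[x_{k,i} : 1 ≤ k ≤ p, 1 ≤ i ≤ n], let J⁺ be the ideal generated by the polynomials q_{i,j} = ∑_{k=1}^p x_{k,i} x_{k,j} for 1 ≤ i ≤ j ≤ n. Then the Krull dimension of the quotient ring ℂ[x_{k,i}]/J⁺ equals np − n(n+1)/2; in particular the codimension of the null cone {A ∈ M_{p,n}(ℂ) : AᵀA = 0} in M_{p,n}(ℂ) equals n(n+1)/2, the number of generators of J⁺, so the null cone is a set-theoretic complete intersection. -/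
open MvPolynomial

theorem MvPolynomial.height_eq_card_of_isMaximal (k : Type*) [Field k] {σ : Type*} [Finite σ]
    (M : Ideal (MvPolynomial σ k)) [M.IsMaximal] : M.height = Nat.card σ := by
  induction σ using Finite.induction_empty_option with
  | of_equiv e ih =>
    have hM : (M.comap (renameEquiv k e).toRingEquiv).IsMaximal :=
      Ideal.comap_isMaximal_of_equiv (renameEquiv k e).toRingEquiv
    rw [← Nat.card_congr e, ← ih (M.comap (renameEquiv k e).toRingEquiv)]
    exact ((renameEquiv k e).toRingEquiv.height_comap M).symm
  | h_empty =>
    have : M = ⊥ := by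
      have hf : IsField (MvPolynomial PEmpty k) :=
        MulEquiv.isField (Field.toIsField k) (MvPolynomial.isEmptyRingEquiv k PEmpty).toMulEquiv
      let := hf.toField
      exact (Ideal.eq_bot_or_top M).resolve_right (Ideal.IsMaximal.ne_top ‹_›)
    subst this
    simp
  | @h_option σ _ ih =>
    let e := (optionEquivLeft k σ).toRingEquiv
    have hP : (M.comap e.symm).IsMaximal := Ideal.comap_isMaximal_of_equiv e.symm
    set P : Ideal (Polynomial (MvPolynomial σ k)) := M.comap e.symm with hPdef
    have hp : (P.under (MvPolynomial σ k)).IsMaximal :=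
      Polynomial.isMaximal_comap_C_of_isJacobsonRing P
    have h1 : P.height = M.height := e.symm.height_comap M
    have : P.LiesOver (P.under (MvPolynomial σ k)) := ⟨rfl⟩
    rw [← h1, Polynomial.height_eq_height_add_one (P.under (MvPolynomial σ k)) P, ih]
    simp

/-- A nontrivial finitely generated algebra `B` over a field of characteristic zero has a prime
whose residue field has at least `dim B` linearly independent derivations. -/
theorem exists_isPrime_ringKrullDim_le_finrank_derivation (k : Type*) [Field k] [CharZero k]
    (B : Type*) [CommRing B] [Nontrivial B] [Algebra k B] [Algebra.FiniteType k B] :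
    ∃ (P : Ideal B) (_ : P.IsPrime), ringKrullDim B ≤
      Module.finrank P.ResidueField (Derivation k P.ResidueField P.ResidueField) := by
  obtain ⟨s, g, hg, hint⟩ := exists_integral_inj_algHom_of_fg k B
  algebraize [g.toRingHom]
  have : IsScalarTower k (MvPolynomial (Fin s) k) B := .of_algHom g
  have hdim : ringKrullDim B ≤ s := by
    have h1 : ringKrullDim B ≤ ringKrullDim (MvPolynomial (Fin s) k) :=
      Order.krullDim_le_of_strictMono (PrimeSpectrum.comap (algebraMap (MvPolynomial (Fin s) k) B))
        fun I J hIJ => Ideal.IsIntegral.comap_lt_comap (I := I.asIdeal) (J := J.asIdeal) hIJ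
    simpa using h1
  obtain ⟨P, -, hP, hP0⟩ := Ideal.exists_ideal_over_prime_of_isIntegral
    (⊥ : Ideal (MvPolynomial (Fin s) k)) (⊥ : Ideal B) (fun x hx => by
      simpa [RingHom.mem_ker] using (map_eq_zero_iff _ hg).1 hx)
  refine ⟨P, hP, ?_⟩
  set S := MvPolynomial (Fin s) k
  set K := P.ResidueField
  have hinj : Function.Injective (algebraMap S K) := by
    rw [injective_iff_map_eq_zero]
    intro x hx
    rw [IsScalarTower.algebraMap_apply S B K, Ideal.algebraMap_residueField_eq_zero] at hx
    have : x ∈ P.comap (algebraMap S B) := hx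
    rwa [hP0] at this
  have : FaithfulSMul S K := (faithfulSMul_iff_algebraMap_injective S K).2 hinj
  let := FractionRing.liftAlgebra S K
  let L := FractionRing S
  have : IsScalarTower S (B ⧸ P) K := .of_algebraMap_eq fun x => by
    rw [IsScalarTower.algebraMap_apply S B K, IsScalarTower.algebraMap_apply S B (B ⧸ P),
      ← IsScalarTower.algebraMap_apply B (B ⧸ P) K]
  have : Algebra.IsAlgebraic L K := isAlgebraic_of_isFractionRing S (B ⧸ P) L K
  have : CharZero L := charZero_of_injective_algebraMap (algebraMap k L).injective
  have : Algebra.FormallyEtale L K := Algebra.FormallyEtale.of_isSeparable L K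
  have : Algebra.FormallyEtale S L := Algebra.FormallyEtale.of_isLocalization (nonZeroDivisors S)
  have : Algebra.FormallyEtale S K := Algebra.FormallyEtale.comp S L K
  let b : Module.Basis (Fin s) K (Ω[K⁄k]) :=
    ((KaehlerDifferential.mvPolynomialBasis k (Fin s)).baseChange K).map
      (KaehlerDifferential.tensorKaehlerEquivOfFormallyEtale k S K)
  have := b.finiteDimensional_of_finite
  let e := KaehlerDifferential.linearMapEquivDerivation k K (M := K)
  rw [← e.finrank_eq, Module.finrank_linearMap, Module.finrank_eq_card_basis b]
  simpa using hdim

theorem Derivation.eq_zero_of_residueField {k B : Type*} [Field k] [CommRing B] [Algebra k B]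
    (P : Ideal B) [P.IsPrime] (D : Derivation k P.ResidueField P.ResidueField)
    (s : Set B) (hs : Algebra.adjoin k s = ⊤) (h : ∀ x ∈ s, D (algebraMap B _ x) = 0) : D = 0 := by
  have hB : ∀ x : B, D (algebraMap B _ x) = 0 := by
    intro x
    have hx : x ∈ Algebra.adjoin k s := hs ▸ Algebra.mem_top
    induction hx using Algebra.adjoin_induction with
    | mem x hx => exact h x hx
    | algebraMap r => rw [← IsScalarTower.algebraMap_apply]; exact D.map_algebraMap r
    | add x y _ _ hx hy => simp [hx, hy]
    | mul x y _ _ hx hy => simp [hx, hy]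
  ext z
  obtain ⟨a, b, hb, rfl⟩ := IsFractionRing.div_surjective (A := B ⧸ P) z
  obtain ⟨a, rfl⟩ := Ideal.Quotient.mk_surjective a
  obtain ⟨b, rfl⟩ := Ideal.Quotient.mk_surjective b
  have hb' : algebraMap B P.ResidueField b ≠ 0 := by
    rw [Ne, Ideal.algebraMap_residueField_eq_zero, ← Ideal.Quotient.eq_zero_iff_mem]
    exact nonZeroDivisors.ne_zero hb
  simp only [Ideal.algebraMap_quotient_residueField_mk]
  have key := D.leibniz (algebraMap B P.ResidueField a / algebraMap B _ b) (algebraMap B _ b)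
  rw [div_mul_cancel₀ _ hb', hB, hB, smul_zero, zero_add, smul_eq_mul] at key
  exact (mul_eq_zero.1 key.symm).resolve_left hb'

section LinearAlgebra

open Module

theorem Submodule.finrank_map_add_finrank_inf_ker {K V W : Type*} [Field K]
    [AddCommGroup V] [Module K V] [FiniteDimensional K V] [AddCommGroup W] [Module K W]
    (f : V →ₗ[K] W) (S : Submodule K V) :
    finrank K (S.map f) + finrank K (S ⊓ f.ker : Submodule K V) = finrank K S := by
  rw [← (f.domRestrict S).finrank_range_add_finrank_ker, LinearMap.range_domRestrict,
    LinearMap.ker_domRestrict, ← Submodule.map_comap_subtype,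
    Submodule.finrank_map_subtype_eq]

theorem finrank_skew_le {K V : Type*} [Field K] [NeZero (2 : K)] [AddCommGroup V] [Module K V]
    [FiniteDimensional K V] (S : Submodule K (V →ₗ[K] V →ₗ[K] K))
    (hS : ∀ β ∈ S, ∀ x y, β x y = - β y x) :
    finrank K S ≤ (finrank K V).choose 2 := by
  let b := finBasis K V
  let ι := {x : Fin (finrank K V) × Fin (finrank K V) // x.1 < x.2}
  let F : (V →ₗ[K] V →ₗ[K] K) →ₗ[K] (ι → K) :=
    { toFun := fun β x => β (b x.1.1) (b x.1.2)
      map_add' := fun _ _ => rfl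
      map_smul' := fun _ _ => rfl }
  have hF : Function.Injective (F.domRestrict S) := by
    have hdiag : ∀ β ∈ S, ∀ x, β x x = 0 := fun β hβ x => by
      have : (2 : K) * β x x = 0 := by linear_combination hS β hβ x x
      exact (mul_eq_zero.1 this).resolve_left two_ne_zero
    rintro ⟨β, hβ⟩ ⟨γ, hγ⟩ h
    have hlt : ∀ i j, i < j → β (b i) (b j) = γ (b i) (b j) :=
      fun i j hij => congrFun h ⟨(i, j), hij⟩
    ext1
    refine b.ext fun i => b.ext fun j => ?_
    rcases lt_trichotomy i j with hij | rfl | hij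
    · exact hlt i j hij
    · exact (hdiag β hβ _).trans (hdiag γ hγ _).symm
    · exact (hS β hβ _ _).trans ((congrArg _ (hlt j i hij)).trans (hS γ hγ _ _).symm)
  have := LinearMap.finrank_le_finrank_of_injective hF
  rw [finrank_fintype_fun_eq_card] at this
  refine this.trans_eq ?_
  rw [Fintype.card_subtype, Fintype.card_product_filter_lt, Fintype.card_fin]

/-- A bound on the dimension of a space of infinitesimal deformations `X` of a map `A`, when these
satisfy `B (X u) (A v) + B (X v) (A u) = 0` and map the kernel of `A` into its range. -/
theorem finrank_infinitesimal_isotropic_le {K V W : Type*} [Field K] [NeZero (2 : K)]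
    [AddCommGroup V] [Module K V] [FiniteDimensional K V]
    [AddCommGroup W] [Module K W] [FiniteDimensional K W]
    (B : W →ₗ[K] W →ₗ[K] K) (hB : Function.Surjective B) (A : V →ₗ[K] W)
    (T : Submodule K (V →ₗ[K] W))
    (hT : ∀ X ∈ T, ∀ u v, B (X u) (A v) = - B (X v) (A u))
    (hker : ∀ X ∈ T, ∀ c ∈ A.ker, X c ∈ A.range) :
    finrank K T ≤ finrank K A.ker * finrank K A.range +
      ((finrank K A.range).choose 2 + finrank K A.range * (finrank K W - finrank K A.range)) := by
  let I := A.range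
  let f : (V →ₗ[K] W) →ₗ[K] (A.ker →ₗ[K] W) := LinearMap.lcomp K W A.ker.subtype
  rw [← Submodule.finrank_map_add_finrank_inf_ker f T]
  refine add_le_add ?_ ?_
  · have hle : T.map f ≤ (LinearMap.compRight K (M := A.ker) I.subtype).range := by
      rintro _ ⟨X, hX, rfl⟩
      exact ⟨LinearMap.codRestrict I (X ∘ₗ A.ker.subtype) fun c => hker X hX c c.2, rfl⟩
    refine (Submodule.finrank_mono hle).trans ((LinearMap.finrank_range_le _).trans_eq ?_)
    exact finrank_linearMap K K A.ker I
  · let S : Submodule K (I →ₗ[K] W) :=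
      (T ⊓ f.ker).comap (LinearMap.lcomp K W A.rangeRestrict)
    have hle : T ⊓ f.ker ≤ S.map (LinearMap.lcomp K W A.rangeRestrict) := by
      rintro X hX
      have hAX : A.ker ≤ X.ker := fun c hc => LinearMap.congr_fun hX.2 ⟨c, hc⟩
      obtain ⟨g, hg⟩ := LinearMap.exists_rightInverse_of_surjective A.rangeRestrict
        A.range_rangeRestrict
      have hY : LinearMap.lcomp K W A.rangeRestrict (X ∘ₗ g) = X := by
        ext v
        have h1 : A (g (A.rangeRestrict v)) = A v :=
          congrArg Subtype.val (LinearMap.congr_fun hg (A.rangeRestrict v))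
        have : g (A.rangeRestrict v) - v ∈ A.ker := by simp [h1]
        have := hAX this
        rw [LinearMap.mem_ker, map_sub, sub_eq_zero] at this
        exact this
      exact ⟨X ∘ₗ g, by rwa [← hY] at hX, hY⟩
    refine (Submodule.finrank_mono hle).trans ((Submodule.finrank_map_le _ _).trans ?_)
    let r : W →ₗ[K] I →ₗ[K] K := I.dualRestrict ∘ₗ B
    have hr : Function.Surjective r := Subspace.dualRestrict_surjective.comp hB
    let g : (I →ₗ[K] W) →ₗ[K] (I →ₗ[K] I →ₗ[K] K) := LinearMap.compRight K r
    have hg : Function.Surjective g := by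
      obtain ⟨s, hs⟩ := r.exists_rightInverse_of_surjective (LinearMap.range_eq_top.2 hr)
      intro β
      refine ⟨s ∘ₗ β, ?_⟩
      change (r ∘ₗ s) ∘ₗ β = β
      rw [hs, LinearMap.id_comp]
    have hgker : finrank K g.ker = finrank K I * (finrank K W - finrank K I) := by
      have := LinearMap.finrank_range_add_finrank_ker
        (V := I →ₗ[K] W) (V₂ := I →ₗ[K] I →ₗ[K] K) g
      rw [LinearMap.range_eq_top.2 hg, finrank_top, finrank_linearMap, finrank_linearMap,
        finrank_linearMap, finrank_self, mul_one] at this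
      rw [Nat.mul_sub, ← this, Nat.add_sub_cancel_left]
    rw [← Submodule.finrank_map_add_finrank_inf_ker
      (V := I →ₗ[K] W) (W := I →ₗ[K] I →ₗ[K] K) g S]
    refine add_le_add (finrank_skew_le _ ?_) ?_
    · rintro _ ⟨Y, hY, rfl⟩ ⟨_, u, rfl⟩ ⟨_, v, rfl⟩
      exact hT _ hY.1 u v
    · rw [← hgker]
      exact Submodule.finrank_mono inf_le_right

end LinearAlgebra

theorem infinitesimal_isotropic_bound {n p k c : ℕ} (hkc : k + c = n) (h : 2 * n < p) :
    c * k + (k.choose 2 + k * (p - k)) ≤ n * p - n * (n + 1) / 2 := by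
  subst hkc
  obtain ⟨d, rfl⟩ : ∃ d, p = k + d := ⟨p - k, by omega⟩
  have h1 : 2 * k.choose 2 + k = k * k := by
    rw [Nat.choose_two_right, Nat.mul_div_cancel' (Nat.even_mul_pred_self k).two_dvd]
    cases k with
    | zero => rfl
    | succ k => rw [Nat.add_sub_cancel]; ring
  have h2 : 2 * ((k + c) * (k + c + 1) / 2) = (k + c) * (k + c + 1) :=
    Nat.mul_div_cancel' (Nat.even_mul_succ_self _).two_dvd
  rw [Nat.add_sub_cancel_left]
  refine Nat.le_sub_of_add_le ?_
  have h3 : c * (k + 2 * c + 1) ≤ c * d := Nat.mul_le_mul_left c (by omega)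
  nlinarith

theorem finrank_derivation_le_of_transpose_mul_self_eq_zero {k K : Type*} [Field k] [Field K]
    [NeZero (2 : K)] [Algebra k K] {p n : ℕ} (h : 2 * n < p) (A : Matrix (Fin p) (Fin n) K)
    (hA : A.transpose * A = 0)
    (hgen : ∀ D : Derivation k K K, (∀ i j, D (A i j) = 0) → D = 0) :
    Module.finrank K (Derivation k K K) ≤ n * p - n * (n + 1) / 2 := by
  let F : Derivation k K K →ₗ[K] ((Fin n → K) →ₗ[K] (Fin p → K)) :=
    { toFun := fun D => Matrix.mulVecLin (A.map D)
      map_add' := fun D E => by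
        rw [← Matrix.mulVecLin_add]; rfl
      map_smul' := fun c D => by
        ext; simp [Matrix.mulVec, dotProduct, Pi.single_apply] }
  have hF : Function.Injective F := by
    refine (injective_iff_map_eq_zero F).2 fun D hD => hgen D fun i j => ?_
    have := congrFun (LinearMap.congr_fun hD (Pi.single j 1)) i
    simpa [F] using this
  have hAA : ∀ i j, ∑ l, A l i * A l j = 0 := fun i j => by
    simpa [Matrix.mul_apply] using congrFun (congrFun hA i) j
  have hXA : ∀ D : Derivation k K K, (A.map D).transpose * A = - (A.transpose * A.map D) := by
    intro D
    ext i j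
    have := congrArg D (hAA i j)
    simp only [map_sum, Derivation.leibniz, smul_eq_mul, map_zero, Finset.sum_add_distrib] at this
    simp only [Matrix.mul_apply, Matrix.transpose_apply, Matrix.map_apply, Matrix.neg_apply]
    rw [eq_neg_iff_add_eq_zero, add_comm, ← this]
    congr 1
    exact Finset.sum_congr rfl fun _ _ => mul_comm _ _
  rw [← LinearMap.finrank_range_of_inj hF]
  have key := finrank_infinitesimal_isotropic_le
    (dotProductEquiv K (Fin p)).toLinearMap (dotProductEquiv K (Fin p)).surjective
    A.mulVecLin F.range ?_ ?_
  · refine key.trans ?_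
    rw [Module.finrank_fin_fun]
    refine infinitesimal_isotropic_bound ?_ h
    rw [LinearMap.finrank_range_add_finrank_ker, Module.finrank_fin_fun]
  · rintro _ ⟨D, rfl⟩ u v
    change (A.map D).mulVec u ⬝ᵥ A.mulVec v = - ((A.map D).mulVec v ⬝ᵥ A.mulVec u)
    have e : ∀ (M N : Matrix (Fin p) (Fin n) K) (x y : Fin n → K),
        M.mulVec x ⬝ᵥ N.mulVec y = x ⬝ᵥ (M.transpose * N).mulVec y := fun M N x y => by
      rw [← Matrix.mulVec_mulVec, Matrix.dotProduct_mulVec x, Matrix.vecMul_transpose]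
    rw [e, hXA, dotProduct_comm (Matrix.mulVec _ v), e, Matrix.neg_mulVec, dotProduct_neg]
  · rintro _ ⟨D, rfl⟩ c hc
    refine ⟨fun j => - D (c j), ?_⟩
    ext i
    have h0 : ∑ j, A i j * c j = 0 := congrFun hc i
    have := congrArg D h0
    simp only [map_sum, Derivation.leibniz, smul_eq_mul, map_zero, Finset.sum_add_distrib] at this
    simp only [F, LinearMap.coe_mk, AddHom.coe_mk, Matrix.mulVecLin_apply, Matrix.mulVec,
      dotProduct, Matrix.map_apply, mul_neg, Finset.sum_neg_distrib]
    rw [neg_eq_iff_add_eq_zero, ← this]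
    congr 1
    exact Finset.sum_congr rfl fun _ _ => mul_comm _ _

theorem le_ringKrullDim_quotient_nullConeIdealO (p n : ℕ) :
    ((n * p - n * (n + 1) / 2 : ℕ) : WithBot ℕ∞) ≤
      ringKrullDim (MvPolynomial (Fin p × Fin n) ℂ ⧸ nullConeIdealO p n) := by
  set s : Set (MvPolynomial (Fin p × Fin n) ℂ) :=
    {f | ∃ i j : Fin n, i ≤ j ∧ f = ∑ k : Fin p, X (k, i) * X (k, j)}
  let φ : MvPolynomial (Fin p × Fin n) ℂ →+* ℂ := constantCoeff
  have hφ : Function.Surjective φ := fun c => ⟨C c, constantCoeff_C _ c⟩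
  have hmax : (RingHom.ker φ).IsMaximal := RingHom.ker_isMaximal_of_surjective φ hφ
  have hsub : s ⊆ RingHom.ker φ := by
    rintro _ ⟨i, j, -, rfl⟩
    simp [φ, RingHom.mem_ker]
  have hcard : s.encard ≤ (n * (n + 1) / 2 : ℕ) := by
    let q : Sym2 (Fin n) → MvPolynomial (Fin p × Fin n) ℂ :=
      Sym2.lift ⟨fun i j => ∑ k : Fin p, X (k, i) * X (k, j), fun i j => by simp only [mul_comm]⟩
    have hsq : s ⊆ Set.range q := by
      rintro _ ⟨i, j, -, rfl⟩
      exact ⟨s(i, j), rfl⟩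
    calc s.encard ≤ (Set.range q).encard := Set.encard_le_encard hsq
      _ ≤ (Set.univ : Set (Sym2 (Fin n))).encard := by
        rw [← Set.image_univ]; exact Set.encard_image_le _ _
      _ = (n * (n + 1) / 2 : ℕ) := by
        rw [Set.encard_univ, ENat.card_eq_coe_fintype_card, Sym2.card, Fintype.card_fin,
          Nat.choose_two_right, Nat.add_sub_cancel, mul_comm]
  have hle := Ideal.height_le_ringKrullDim_quotient_add_encard s hsub
  rw [MvPolynomial.height_eq_card_of_isMaximal ℂ (RingHom.ker φ)] at hle
  have hfin : ringKrullDim (MvPolynomial (Fin p × Fin n) ℂ ⧸ Ideal.span s) +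
      ((n * (n + 1) / 2 : ℕ) : WithBot ℕ∞) ≥ ((n * p : ℕ) : WithBot ℕ∞) := by
    refine le_trans ?_ (hle.trans ?_)
    · simp [mul_comm]
    · gcongr
      exact_mod_cast hcard
  change _ ≤ ringKrullDim (MvPolynomial (Fin p × Fin n) ℂ ⧸ Ideal.span s)
  generalize ringKrullDim (MvPolynomial (Fin p × Fin n) ℂ ⧸ Ideal.span s) = d at hfin ⊢
  induction d with
  | bot =>
    rw [WithBot.bot_add, ge_iff_le, le_bot_iff] at hfin
    exact absurd hfin (WithBot.coe_ne_bot (a := ((n * p : ℕ) : ℕ∞)))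
  | coe d =>
    induction d with
    | top => exact le_top
    | coe d =>
      have : n * p ≤ d + n * (n + 1) / 2 := by exact_mod_cast hfin
      exact WithBot.coe_le_coe.2 (WithTop.coe_le_coe.2 (Nat.sub_le_of_le_add this))

theorem ringKrullDim_quotient_nullConeIdealO_le {p n : ℕ} (h : 2 * n < p) :
    ringKrullDim (MvPolynomial (Fin p × Fin n) ℂ ⧸ nullConeIdealO p n) ≤
      ((n * p - n * (n + 1) / 2 : ℕ) : WithBot ℕ∞) := by
  let R := MvPolynomial (Fin p × Fin n) ℂ
  let B := R ⧸ nullConeIdealO p n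
  rcases subsingleton_or_nontrivial B with hB | hB
  · rw [ringKrullDim_eq_bot_of_subsingleton]
    exact bot_le
  obtain ⟨P, _, hdim⟩ := exists_isPrime_ringKrullDim_le_finrank_derivation ℂ B
  refine hdim.trans ?_
  let x : Fin p × Fin n → B := fun i => Ideal.Quotient.mk _ (X i)
  have hx : Algebra.adjoin ℂ (Set.range x) = ⊤ := by
    have := congrArg (Subalgebra.map (Ideal.Quotient.mkₐ ℂ (nullConeIdealO p n)))
      (MvPolynomial.adjoin_range_X (R := ℂ) (σ := Fin p × Fin n))
    rw [AlgHom.map_adjoin, ← Set.range_comp, Algebra.map_top,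
      (AlgHom.range_eq_top _).2 (Ideal.Quotient.mkₐ_surjective _ _)] at this
    exact this
  have hq : ∀ i j, ∑ k, x (k, i) * x (k, j) = 0 := by
    have hle : ∀ i j, i ≤ j → ∑ k, x (k, i) * x (k, j) = 0 := fun i j hij => by
      have : (∑ k : Fin p, X (k, i) * X (k, j) : R) ∈ nullConeIdealO p n :=
        Ideal.subset_span ⟨i, j, hij, rfl⟩
      simpa [x] using Ideal.Quotient.eq_zero_iff_mem.2 this
    intro i j
    rcases le_total i j with hij | hij
    · exact hle i j hij
    · rw [← hle j i hij]
      exact Finset.sum_congr rfl fun _ _ => mul_comm _ _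
  have : CharZero P.ResidueField := charZero_of_injective_algebraMap (algebraMap ℂ _).injective
  let A : Matrix (Fin p) (Fin n) P.ResidueField := fun k i => algebraMap B _ (x (k, i))
  have := finrank_derivation_le_of_transpose_mul_self_eq_zero (k := ℂ) h A
    (by
      ext i j
      rw [Matrix.mul_apply]
      change ∑ k, algebraMap B P.ResidueField (x (k, i)) *
        algebraMap B P.ResidueField (x (k, j)) = 0
      simp only [← map_mul, ← map_sum, hq, map_zero])
    (fun D hD => Derivation.eq_zero_of_residueField P D (Set.range x) hx (by
      rintro _ ⟨⟨k, i⟩, rfl⟩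
      exact hD k i))
  exact_mod_cast this

/-- In the stable range `2n < p`, the Krull dimension of the coordinate ring of the
null cone `{A ∈ M_{p,n}(ℂ) : AᵀA = 0}` equals `np - n(n+1)/2`; so the null cone has
codimension `n(n+1)/2` in `M_{p,n}(ℂ)`, the number of generators of its ideal,
i.e. it is a set-theoretic complete intersection. -/
theorem nullConeO_krullDim (p n : ℕ) (hp : 0 < p) (hn : 0 < n) (h : 2 * n < p) :
    ringKrullDim (MvPolynomial (Fin p × Fin n) ℂ ⧸ nullConeIdealO p n) =
      ((n * p - n * (n + 1) / 2 : ℕ) : WithBot (WithTop ℕ)) := by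
  exact le_antisymm (ringKrullDim_quotient_nullConeIdealO_le h)
    (le_ringKrullDim_quotient_nullConeIdealO p n)
end

section
/- Let p, n be positive integers with n ≤ p. In the polynomial ring ℂ[x_{k,i} : 1 ≤ k ≤ 2p, 1 ≤ i ≤ n], let J⁺ be the ideal generated by the n(n−1)/2 polynomials r_{i,j} = ∑_{k=1}^p (x_{k,i} x_{k+p,j} − x_{k+p,i} x_{k,j}) for 1 ≤ i < j ≤ n (the entries of AᵀJ_pA above the diagonal). Then J⁺ is a prime ideal, the quotient ring ℂ[x_{k,i}]/J⁺ is an integrally closed integral domain, and its Krull dimension equals 2pn − n(n−1)/2. (That is, the null cone {A ∈ M_{2p,n}(ℂ) : AᵀJ_pA = 0} is an irreducible normal variety which is a set-theoretic complete intersection of codimension n(n−1)/2.) -/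
open MvPolynomial

/-- The index `k` (for `1 ≤ k ≤ p`) viewed inside `Fin (2*p)`. -/
def finLow (p : ℕ) (k : Fin p) : Fin (2 * p) := ⟨(k : ℕ), by omega⟩

/-- The index `k + p` (for `1 ≤ k ≤ p`) viewed inside `Fin (2*p)`. -/
def finHigh (p : ℕ) (k : Fin p) : Fin (2 * p) := ⟨(k : ℕ) + p, by omega⟩

/-- The ideal of the null cone `{A ∈ M_{2p,n}(ℂ) : AᵀJ_pA = 0}`, generated by the
`n(n-1)/2` quadratic invariants
`r_{i,j} = ∑_{k=1}^p (x_{k,i} x_{k+p,j} - x_{k+p,i} x_{k,j})` for `i < j`. -/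
noncomputable def nullConeIdealSp (p n : ℕ) :
    Ideal (MvPolynomial (Fin (2 * p) × Fin n) ℂ) :=
  Ideal.span
    {f | ∃ i j : Fin n, i < j ∧
      f = ∑ k : Fin p,
            (X (finLow p k, i) * X (finHigh p k, j) -
             X (finHigh p k, i) * X (finLow p k, j))}

theorem isIntegrallyClosed_of_isLocalization_away {A B : Type*} [CommRing A] [CommRing B]
    [Algebra A B] {x : A} [IsLocalization.Away x B] [IsDomain B] [IsIntegrallyClosed B]
    (hx : x ∈ nonZeroDivisors A) (hred : (Ideal.span {x}).IsRadical) :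
    IsDomain A ∧ IsIntegrallyClosed A := by
  have hle : Submonoid.powers x ≤ nonZeroDivisors A := by
    simpa [Submonoid.powers_le] using hx
  have hA : IsDomain A := (IsLocalization.injective B hle).isDomain (algebraMap A B)
  refine ⟨hA, ?_⟩
  let K := FractionRing A
  let g : B →+* K := IsLocalization.map _ (T := nonZeroDivisors A) (RingHom.id A) hle
  let := g.toAlgebra
  have : IsScalarTower A B K := IsScalarTower.of_algebraMap_eq'
    ((IsLocalization.map_comp (Q := K) hle).trans (RingHom.comp_id _)).symm
  have := IsFractionRing.isFractionRing_of_isDomain_of_isLocalization (Submonoid.powers x) B K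
  rw [isIntegrallyClosed_iff K]
  intro z hz
  obtain ⟨b, rfl⟩ := (isIntegrallyClosed_iff K).mp ‹IsIntegrallyClosed B› (hz.tower_top (A := B))
  obtain ⟨⟨a, ⟨_, k, rfl⟩⟩, hab⟩ := IsLocalization.surj (Submonoid.powers x) b
  have hab' : algebraMap B K b * algebraMap A K (x ^ k) = algebraMap A K a := by
    have := congrArg (algebraMap B K) hab
    simpa [← IsScalarTower.algebraMap_apply A B K] using this
  clear hab
  have hx0 : algebraMap A K x ≠ 0 := by
    simpa using nonZeroDivisors.ne_zero hx
  generalize algebraMap B K b = z at *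
  induction k generalizing a with
  | zero => exact ⟨a, by simpa using hab'.symm⟩
  | succ k ih =>
    have hmem : a ∈ Ideal.span {x} := by
      obtain ⟨q, hq, hq0⟩ := hz
      apply hred
      refine ⟨q.natDegree, ?_⟩
      have h1 : Polynomial.aeval (algebraMap A K a) (q.scaleRoots (x ^ (k + 1))) = 0 := by
        rw [← hab', mul_comm]
        exact Polynomial.scaleRoots_aeval_eq_zero hq0
      rw [Polynomial.aeval_algebraMap_apply, FaithfulSMul.algebraMap_eq_zero_iff,
        Polynomial.aeval_def, Polynomial.eval₂_eq_sum_range, Polynomial.natDegree_scaleRoots,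
        Finset.sum_range_succ] at h1
      simp only [Polynomial.coeff_scaleRoots, hq.coeff_natDegree, Algebra.algebraMap_self,
        RingHom.id_apply, Nat.sub_self, pow_zero, mul_one, one_mul] at h1
      rw [eq_neg_of_add_eq_zero_right h1]
      refine neg_mem (sum_mem fun i hi => ?_)
      have : q.natDegree - i ≠ 0 := by simp at hi; omega
      refine Ideal.mul_mem_right _ _ (Ideal.mul_mem_left _ _ ?_)
      rw [← pow_mul]
      exact Ideal.pow_mem_of_mem _ (Ideal.mem_span_singleton_self x) _ (by positivity)
    obtain ⟨c, rfl⟩ := Ideal.mem_span_singleton'.mp hmem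
    refine ih c ?_
    apply mul_right_cancel₀ hx0
    rw [mul_assoc, ← map_mul, ← pow_succ, hab', map_mul]

theorem MvPolynomial.isIntegrallyClosed {σ R : Type*} [Finite σ] [CommRing R] [IsDomain R]
    [IsIntegrallyClosed R] : IsIntegrallyClosed (MvPolynomial σ R) := by
  induction σ using Finite.induction_empty_option with
  | of_equiv e h => exact IsIntegrallyClosed.of_equiv (renameEquiv R e).toRingEquiv
  | h_empty => exact IsIntegrallyClosed.of_equiv (isEmptyRingEquiv R PEmpty).symm
  | h_option h => exact IsIntegrallyClosed.of_equiv (optionEquivLeft R _).symm.toRingEquiv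

theorem ringKrullDim_eq_toNat_trdeg (k : Type*) {A : Type*} [Field k] [CommRing A] [IsDomain A]
    [Algebra k A] [Algebra.FiniteType k A] :
    ringKrullDim A = (Cardinal.toNat (Algebra.trdeg k A) : WithBot ℕ∞) := by
  obtain ⟨s, g, hg, hint⟩ := exists_integral_inj_algHom_of_fg k A
  algebraize [g.toRingHom]
  have : FaithfulSMul (MvPolynomial (Fin s) k) A :=
    (faithfulSMul_iff_algebraMap_injective _ _).mpr hg
  have : Algebra.IsIntegral (MvPolynomial (Fin s) k) A := ⟨hint⟩
  have : IsScalarTower k (MvPolynomial (Fin s) k) A := .of_algebraMap_eq' g.comp_algebraMap.symm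
  have h1 : Cardinal.toNat (Algebra.trdeg k A) = s := by
    have := congrArg Cardinal.toNat (lift_trdeg_add_eq k (MvPolynomial (Fin s) k) A)
    have h0 : Algebra.trdeg (MvPolynomial (Fin s) k) A = 0 := trdeg_eq_zero
    simpa [h0] using this.symm
  rw [h1]
  have h2 : ringKrullDim (MvPolynomial (Fin s) k) = s := by simp
  rw [← h2]
  apply le_antisymm
  · refine Order.krullDim_le_of_strictMono
      (PrimeSpectrum.comap (algebraMap (MvPolynomial (Fin s) k) A)) fun I J h => ?_
    exact Ideal.IsIntegral.comap_lt_comap (R := MvPolynomial (Fin s) k) h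
  · refine iSup_le fun l => ?_
    obtain ⟨P, hP, hPo⟩ := Ideal.exists_ideal_over_prime_of_isIntegral_of_isDomain
      (S := A) l.last.asIdeal (by simp [(RingHom.injective_iff_ker_eq_bot _).mp
        (FaithfulSMul.algebraMap_injective (MvPolynomial (Fin s) k) A)])
    have : P.LiesOver l.last.asIdeal := ⟨hPo.symm⟩
    obtain ⟨L, hL, -⟩ := Ideal.exists_ltSeries_of_hasGoingDown l P
    rw [← hL]
    exact le_iSup (fun p : LTSeries (PrimeSpectrum A) => (p.length : WithBot ℕ∞)) L

namespace MonomialOrder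
variable {σ : Type*}

/-- The additive map sending a monomial to its weight, with ties to be broken by `m`. -/
noncomputable def weightedHom (m : MonomialOrder σ) (w : σ → ℕ) : (σ →₀ ℕ) →+ ℕ ×ₗ m.syn where
  toFun d := toLex (Finsupp.weight w d, m.toSyn d)
  map_zero' := by simp
  map_add' a b := by rw [map_add, map_add]; rfl

theorem weightedHom_injective (m : MonomialOrder σ) (w : σ → ℕ) :
    Function.Injective (m.weightedHom w) := fun a b h => by
  have : (Finsupp.weight w a, m.toSyn a) = (Finsupp.weight w b, m.toSyn b) := h
  simpa using (Prod.ext_iff.mp this).2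

/-- The monomials, ordered by weight with ties broken by `m`. -/
def WeightedSyn (_ : MonomialOrder σ) (_ : σ → ℕ) : Type _ := σ →₀ ℕ

namespace WeightedSyn
variable (m : MonomialOrder σ) (w : σ → ℕ)

noncomputable instance : AddCommMonoid (m.WeightedSyn w) :=
  inferInstanceAs (AddCommMonoid (σ →₀ ℕ))

/-- The identity, as a map to the type of monomials ordered by weight. -/
noncomputable def equiv : (σ →₀ ℕ) ≃+ m.WeightedSyn w := AddEquiv.refl _

/-- The map `MonomialOrder.weightedHom` defining the order on `WeightedSyn`. -/
noncomputable def hom : m.WeightedSyn w →+ ℕ ×ₗ m.syn := m.weightedHom w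

noncomputable instance : LinearOrder (m.WeightedSyn w) :=
  LinearOrder.lift' (hom m w) (m.weightedHom_injective w)

theorem le_iff {a b : m.WeightedSyn w} : a ≤ b ↔ hom m w a ≤ hom m w b := Iff.rfl

instance : IsOrderedAddMonoid (m.WeightedSyn w) where
  add_le_add_left a b h c := by
    rw [le_iff] at h ⊢
    rw [map_add, map_add]
    gcongr

instance : WellFoundedLT (m.WeightedSyn w) :=
  ⟨InvImage.wf (hom m w) wellFounded_lt⟩

end WeightedSyn

/-- The monomial order comparing weights first and breaking ties using `m`. -/
noncomputable def weighted (m : MonomialOrder σ) (w : σ → ℕ) : MonomialOrder σ where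
  syn := m.WeightedSyn w
  toSyn := WeightedSyn.equiv m w
  toSyn_monotone a b h := by
    obtain ⟨c, rfl⟩ := le_iff_exists_add.mp h
    refine Prod.Lex.toLex_mono (Prod.mk_le_mk.mpr ⟨?_, m.toSyn_monotone h⟩)
    change Finsupp.weight w a ≤ Finsupp.weight w (a + c)
    simp

theorem weighted_lt_of_weight_lt (m : MonomialOrder σ) (w : σ → ℕ) {a b : σ →₀ ℕ}
    (h : Finsupp.weight w a < Finsupp.weight w b) :
    (m.weighted w).toSyn a < (m.weighted w).toSyn b :=
  Prod.Lex.left _ _ h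
end MonomialOrder

namespace MonomialOrder
variable {σ R ι : Type*} [CommRing R] (m : MonomialOrder σ)

theorem degree_sub_smul_lt {g b : MvPolynomial σ R} (hb : m.Monic b)
    (hd : m.degree b = m.degree g) (h0 : g - m.leadingCoeff g • b ≠ 0) :
    m.toSyn (m.degree (g - m.leadingCoeff g • b)) < m.toSyn (m.degree g) := by
  have hle : m.toSyn (m.degree (g - m.leadingCoeff g • b)) ≤ m.toSyn (m.degree g) := by
    refine m.degree_sub_le.trans (sup_le le_rfl ?_)
    rw [← hd]
    exact m.degree_smul_le
  refine lt_of_le_of_ne hle fun h => ?_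
  have h1 := m.coeff_degree_ne_zero_iff.mpr h0
  rw [m.toSyn.injective h, coeff_sub, coeff_smul, ← hd, hb.coeff_degree, hd] at h1
  exact h1 (by simp [leadingCoeff])

theorem mem_span_of_monic_degree {b : (σ →₀ ℕ) → MvPolynomial σ R}
    (hb : ∀ u, m.Monic (b u)) (hd : ∀ u, m.degree (b u) = u) (g : MvPolynomial σ R) :
    g ∈ Submodule.span R (Set.range b) := by
  induction h : m.toSyn (m.degree g) using WellFoundedLT.induction generalizing g with
  | ind d ih =>
    by_cases h0 : g - m.leadingCoeff g • b (m.degree g) = 0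
    · rw [sub_eq_zero.mp h0]
      exact Submodule.smul_mem _ _ (Submodule.subset_span (Set.mem_range_self _))
    · have := ih _ (h ▸ m.degree_sub_smul_lt (hb _) (hd _) h0) _ rfl
      exact (Submodule.sub_mem_iff_left _
        (Submodule.smul_mem _ _ (Submodule.subset_span (Set.mem_range_self _)))).mp this

theorem degree_mem_of_mem_span {b : (σ →₀ ℕ) → MvPolynomial σ R}
    (hb : ∀ u, m.Monic (b u)) (hd : ∀ u, m.degree (b u) = u) {U : Set (σ →₀ ℕ)}
    {g : MvPolynomial σ R} (hg : g ∈ Submodule.span R (b '' U)) (h0 : g ≠ 0) :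
    m.degree g ∈ U := by
  obtain ⟨c, hc, rfl⟩ := (Finsupp.mem_span_image_iff_linearCombination R).mp hg
  have hc0 : c ≠ 0 := by rintro rfl; simp at h0
  obtain ⟨u, hu, hmax⟩ := c.support.exists_max_image m.toSyn (by simpa using hc0)
  suffices m.degree (Finsupp.linearCombination R b c) = u from this ▸ hc hu
  have hle : m.toSyn (m.degree (Finsupp.linearCombination R b c)) ≤ m.toSyn u := by
    rw [Finsupp.linearCombination_apply]
    refine m.degree_sum_le.trans (Finset.sup_le fun v hv => ?_)
    refine m.degree_smul_le.trans ?_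
    rw [hd]
    exact hmax v hv
  refine m.toSyn.injective (le_antisymm hle (m.le_degree ?_))
  rw [mem_support_iff, Finsupp.linearCombination_apply, Finsupp.sum, coeff_sum,
    Finset.sum_eq_single u]
  · have := (hb u).coeff_degree
    rw [hd] at this
    simpa [coeff_smul, this] using hu
  · intro v hv hvu
    rw [coeff_smul, m.coeff_eq_zero_of_lt, smul_zero]
    rw [hd]
    exact lt_of_le_of_ne (hmax v hv) (by simpa using hvu)
  · exact fun h => absurd hu h

section Coprime

/-- The exponent of the squarefree monomial with support `M`. -/
noncomputable def sqfreeExp (M : Finset σ) : σ →₀ ℕ := ∑ s ∈ M, Finsupp.single s 1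

theorem sqfreeExp_apply [DecidableEq σ] (M : Finset σ) (s : σ) :
    sqfreeExp M s = if s ∈ M then 1 else 0 := by
  simp [sqfreeExp, Finsupp.finsetSum_apply, Finsupp.single_apply]

theorem sqfreeExp_le_iff {M : Finset σ} {u : σ →₀ ℕ} :
    sqfreeExp M ≤ u ↔ ∀ s ∈ M, u s ≠ 0 := by
  classical
  simp only [Finsupp.le_def, sqfreeExp_apply]
  refine forall_congr' fun s => ?_
  split_ifs with h <;> simp [h, Nat.one_le_iff_ne_zero]

/-- The exponent of the highest power of the squarefree monomial with support `M` dividing the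
monomial `u`. -/
noncomputable def sqfreeMult (M : Finset σ) (u : σ →₀ ℕ) : ℕ := sInf (u '' M)

theorem sqfreeMult_le {M : Finset σ} {u : σ →₀ ℕ} {s : σ} (hs : s ∈ M) : sqfreeMult M u ≤ u s :=
  Nat.sInf_le ⟨s, hs, rfl⟩

theorem sqfreeMult_add_self {M : Finset σ} (hM : M.Nonempty) (u : σ →₀ ℕ) :
    sqfreeMult M (u + sqfreeExp M) = sqfreeMult M u + 1 := by
  classical
  have hne : (u '' (M : Set σ)).Nonempty := by simpa using hM
  have hne' : ((u + sqfreeExp M) '' (M : Set σ)).Nonempty := by simpa using hM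
  apply le_antisymm
  · obtain ⟨s, hs, h⟩ := Nat.sInf_mem hne
    refine (sqfreeMult_le (s := s) hs).trans ?_
    rw [sqfreeMult, ← h, Finsupp.add_apply, sqfreeExp_apply, if_pos (by simpa using hs)]
  · refine le_csInf hne' ?_
    rintro _ ⟨s, hs, rfl⟩
    rw [Finsupp.add_apply, sqfreeExp_apply, if_pos (by simpa using hs)]
    simpa using sqfreeMult_le hs

theorem sqfreeMult_add_of_disjoint {M N : Finset σ} (h : Disjoint M N) (u : σ →₀ ℕ) :
    sqfreeMult M (u + sqfreeExp N) = sqfreeMult M u := by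
  classical
  unfold sqfreeMult
  congr 1
  refine Set.image_congr fun s hs => ?_
  rw [Finsupp.add_apply, sqfreeExp_apply, if_neg (Finset.disjoint_left.mp h hs), add_zero]

variable {M : ι → Finset σ}

theorem sum_sqfreeMult_smul_le [Fintype ι] (hdisj : Pairwise (Function.onFun Disjoint M))
    (u : σ →₀ ℕ) : ∑ i, sqfreeMult (M i) u • sqfreeExp (M i) ≤ u := by
  classical
  intro s
  simp only [Finsupp.finsetSum_apply, Finsupp.smul_apply, sqfreeExp_apply, smul_eq_mul, mul_ite,
    mul_one, mul_zero]
  by_cases hs : ∃ i, s ∈ M i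
  · obtain ⟨i, hi⟩ := hs
    rw [Finset.sum_eq_single i, if_pos hi]
    · exact sqfreeMult_le hi
    · exact fun j _ hj => if_neg fun h => Finset.disjoint_left.mp (hdisj hj) h hi
    · simp
  · push Not at hs
    simp [hs]

/-- The product of powers of the `f i` and of a monomial divisible by none of the squarefree
monomials with supports `M i`, whose leading monomial is `u` when the `f i` have those leading
monomials. -/
noncomputable def coprimeBasis [Fintype ι] (M : ι → Finset σ) (f : ι → MvPolynomial σ R)
    (u : σ →₀ ℕ) : MvPolynomial σ R :=
  (∏ i, f i ^ sqfreeMult (M i) u) *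
    monomial (u - ∑ i, sqfreeMult (M i) u • sqfreeExp (M i)) 1

variable {f : ι → MvPolynomial σ R}

theorem coprimeBasis_add [Fintype ι] (hne : ∀ i, (M i).Nonempty)
    (hdisj : Pairwise (Function.onFun Disjoint M)) (u : σ →₀ ℕ) (i : ι) :
    coprimeBasis M f (u + sqfreeExp (M i)) = f i * coprimeBasis M f u := by
  classical
  have h (j : ι) : sqfreeMult (M j) (u + sqfreeExp (M i)) =
      sqfreeMult (M j) u + if j = i then 1 else 0 := by
    split_ifs with hj
    · subst hj; exact sqfreeMult_add_self (hne j) u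
    · exact sqfreeMult_add_of_disjoint (hdisj hj) u
  simp only [coprimeBasis, h, add_smul, pow_add, Finset.sum_add_distrib, Finset.prod_mul_distrib,
    ite_smul, one_smul, zero_smul, Finset.sum_ite_eq', Finset.mem_univ, if_true, pow_ite, pow_one,
    pow_zero, Finset.prod_ite_eq', add_tsub_add_eq_tsub_right]
  ring

theorem monic_coprimeBasis [Fintype ι] (hf : ∀ i, m.Monic (f i)) (u : σ →₀ ℕ) :
    m.Monic (coprimeBasis M f u) :=
  (Monic.prod fun i _ => (hf i).pow).mul m.monic_monomial_one

theorem degree_coprimeBasis [Fintype ι] [IsDomain R] (hf : ∀ i, m.Monic (f i))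
    (hd : ∀ i, m.degree (f i) = sqfreeExp (M i))
    (hdisj : Pairwise (Function.onFun Disjoint M)) (u : σ →₀ ℕ) :
    m.degree (coprimeBasis M f u) = u := by
  classical
  rw [coprimeBasis, m.degree_mul, m.degree_prod, m.degree_monomial, if_neg one_ne_zero]
  · simp only [m.degree_pow, hd]
    exact add_tsub_cancel_of_le (sum_sqfreeMult_smul_le hdisj u)
  · exact fun i _ => pow_ne_zero _ (hf i).ne_zero
  · exact Finset.prod_ne_zero_iff.mpr fun i _ => pow_ne_zero _ (hf i).ne_zero
  · simp

theorem exists_sqfreeExp_le_degree [Fintype ι] [IsDomain R] (hf : ∀ i, m.Monic (f i))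
    (hd : ∀ i, m.degree (f i) = sqfreeExp (M i)) (hne : ∀ i, (M i).Nonempty)
    (hdisj : Pairwise (Function.onFun Disjoint M)) {g : MvPolynomial σ R}
    (hg : g ∈ Ideal.span (Set.range f)) (h0 : g ≠ 0) : ∃ i, sqfreeExp (M i) ≤ m.degree g := by
  refine m.degree_mem_of_mem_span (m.monic_coprimeBasis hf)
    (m.degree_coprimeBasis hf hd hdisj) (U := {u | ∃ i, sqfreeExp (M i) ≤ u}) ?_ h0
  obtain ⟨c, rfl⟩ := Ideal.mem_span_range_iff_exists_fun.mp hg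
  refine sum_mem fun i _ => ?_
  have hc := m.mem_span_of_monic_degree (m.monic_coprimeBasis hf)
    (m.degree_coprimeBasis hf hd hdisj) (c i)
  generalize c i = y at hc ⊢
  induction hc using Submodule.span_induction with
  | mem x hx =>
    obtain ⟨u, rfl⟩ := hx
    refine Submodule.subset_span ⟨u + sqfreeExp (M i), ⟨i, le_add_self⟩, ?_⟩
    rw [coprimeBasis_add hne hdisj, mul_comm]
  | zero => simp
  | add x y _ _ hx hy => rw [add_mul]; exact add_mem hx hy
  | smul a x _ hx => rw [smul_mul_assoc]; exact Submodule.smul_mem _ _ hx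

theorem mem_of_reduce [IsDomain R] (hf : ∀ i, m.Monic (f i))
    (hd : ∀ i, m.degree (f i) = sqfreeExp (M i)) {J : Ideal (MvPolynomial σ R)}
    (hle : Ideal.span (Set.range f) ≤ J)
    (hJ : ∀ g ∈ J, g ≠ 0 → ∃ i, sqfreeExp (M i) ≤ m.degree g) :
    J ≤ Ideal.span (Set.range f) := by
  classical
  intro g hg
  induction h : m.toSyn (m.degree g) using WellFoundedLT.induction generalizing g with
  | ind d ih =>
    by_cases hg0 : g = 0
    · rw [hg0]; exact zero_mem _
    obtain ⟨i, hi⟩ := hJ g hg hg0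
    set b := monomial (m.degree g - sqfreeExp (M i)) (1 : R) * f i with hbdef
    have hb : m.Monic b := m.monic_monomial_one.mul (hf i)
    have hbd : m.degree b = m.degree g := by
      rw [hbdef, m.degree_mul (by simp) (hf i).ne_zero, m.degree_monomial, if_neg one_ne_zero, hd]
      exact tsub_add_cancel_of_le hi
    have hbm : m.leadingCoeff g • b ∈ Ideal.span (Set.range f) :=
      Submodule.smul_of_tower_mem _ _ (Ideal.mul_mem_left _ _ (Ideal.subset_span ⟨i, rfl⟩))
    by_cases h0 : g - m.leadingCoeff g • b = 0
    · rwa [sub_eq_zero.mp h0]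
    · exact (Submodule.sub_mem_iff_left _ hbm).mp
        (ih _ (h ▸ m.degree_sub_smul_lt hb hbd h0) (sub_mem hg (hle hbm)) rfl)

theorem isRadical_span_of_coprime [Fintype ι] [IsDomain R] (hf : ∀ i, m.Monic (f i))
    (hd : ∀ i, m.degree (f i) = sqfreeExp (M i)) (hne : ∀ i, (M i).Nonempty)
    (hdisj : Pairwise (Function.onFun Disjoint M)) : (Ideal.span (Set.range f)).IsRadical := by
  refine m.mem_of_reduce hf hd Ideal.le_radical fun g ⟨k, hk⟩ h0 => ?_
  obtain ⟨i, hi⟩ := m.exists_sqfreeExp_le_degree hf hd hne hdisj hk (pow_ne_zero _ h0)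
  refine ⟨i, ?_⟩
  rw [sqfreeExp_le_iff] at hi ⊢
  intro s hs h
  exact hi s hs (by simp [m.degree_pow, h])

theorem mem_span_of_X_mul_mem [Fintype ι] [IsDomain R] (hf : ∀ i, m.Monic (f i))
    (hd : ∀ i, m.degree (f i) = sqfreeExp (M i)) (hne : ∀ i, (M i).Nonempty)
    (hdisj : Pairwise (Function.onFun Disjoint M)) {s : σ} (hs : ∀ i, s ∉ M i)
    {g : MvPolynomial σ R}
    (hg : X s * g ∈ Ideal.span (Set.range f)) : g ∈ Ideal.span (Set.range f) := by
  classical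
  refine m.mem_of_reduce hf hd (J := Submodule.comap
    (LinearMap.mulLeft (MvPolynomial σ R) (X s)) (Ideal.span (Set.range f)))
    (fun x hx => ?_) (fun x hx h0 => ?_) hg
  · exact Ideal.mul_mem_left _ _ hx
  · obtain ⟨i, hi⟩ := m.exists_sqfreeExp_le_degree hf hd hne hdisj hx
      (mul_ne_zero (X_ne_zero s) h0)
    refine ⟨i, ?_⟩
    rw [sqfreeExp_le_iff] at hi ⊢
    intro t ht h
    have hst : s ≠ t := fun h => hs i (h ▸ ht)
    refine hi t ht ?_
    simp [m.degree_mul (X_ne_zero s) h0, h, m.degree_X, hst]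

end Coprime
end MonomialOrder

/-- The alternating form `uᵀv - vᵀu`, for matrices `u` and `v` with columns indexed by `ι`. -/
def altForm {A κ ι : Type*} [CommRing A] [Fintype κ] (u v : κ → ι → A) (i j : ι) : A :=
  ∑ k, (u k i * v k j - v k i * u k j)

/-- The variables: two copies of the entries of a `p × n` matrix. -/
abbrev SpVar (p n : ℕ) : Type := (Fin p × Fin n) ⊕ (Fin p × Fin n)

/-- The universal quadratic invariants. -/
noncomputable def spInvariant (p n : ℕ) (ij : {ij : Fin n × Fin n // ij.1 < ij.2}) :
    MvPolynomial (SpVar p n) ℂ :=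
  altForm (fun k i => X (Sum.inl (k, i))) (fun k i => X (Sum.inr (k, i))) ij.1.1 ij.1.2

namespace MonomialOrder
theorem monic_and_degree_of_weight {σ R : Type*} [CommRing R] [Nontrivial R] (m : MonomialOrder σ)
    (w : σ → ℕ) {a : σ →₀ ℕ}
    {f : MvPolynomial σ R}
    (h : f - monomial a 1 ∈ restrictSupport R {d | Finsupp.weight w d < Finsupp.weight w a}) :
    (m.weighted w).Monic f ∧ (m.weighted w).degree f = a := by
  classical
  obtain ⟨g, rfl⟩ : ∃ g, f = monomial a 1 + g := ⟨f - monomial a 1, by ring⟩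
  rw [add_sub_cancel_left, mem_restrictSupport_iff] at h
  have ha : (m.weighted w).degree (monomial a (1 : R)) = a := by simp [degree_monomial]
  by_cases hg : g = 0
  · subst hg
    rw [add_zero]
    exact ⟨monic_monomial_one, ha⟩
  have hlt : (m.weighted w).toSyn ((m.weighted w).degree g) <
      (m.weighted w).toSyn ((m.weighted w).degree (monomial a (1 : R))) := by
    rw [ha]
    exact m.weighted_lt_of_weight_lt w (h (degree_mem_support hg))
  exact ⟨monic_monomial_one.add_of_lt hlt, (degree_add_of_lt hlt).trans ha⟩
end MonomialOrder

/-- Weights of the variables for which `spInvariant p n ⟨(i, j), _⟩` has leading monomial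
`x_{j-i,i} y_{j-i,j}`. -/
def spWeight (p n : ℕ) : SpVar p n → ℕ
  | .inl (k, i) => 2 * n * p + p ^ 2 - 2 * i * k
  | .inr (k, j) => 2 * n * p + p ^ 2 + 2 * j * k - k ^ 2

theorem spWeight_inl (p n : ℕ) (k : Fin p) (i : Fin n) :
    (spWeight p n (.inl (k, i)) : ℤ) = 2 * n * p + p ^ 2 - 2 * i * k := by
  have : (i : ℕ) * k ≤ n * p := Nat.mul_le_mul i.2.le k.2.le
  rw [spWeight, Nat.cast_sub (by nlinarith)]
  push_cast; ring

theorem spWeight_inr (p n : ℕ) (k : Fin p) (j : Fin n) :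
    (spWeight p n (.inr (k, j)) : ℤ) = 2 * n * p + p ^ 2 + 2 * j * k - k ^ 2 := by
  have : (k : ℕ) ^ 2 ≤ p ^ 2 := Nat.pow_le_pow_left k.2.le 2
  rw [spWeight, Nat.cast_sub (by nlinarith)]
  push_cast; ring

/-- The support of the leading monomial of `spInvariant p n ij`. -/
def spLead {p n : ℕ} (h : n ≤ p) (ij : {ij : Fin n × Fin n // ij.1 < ij.2}) :
    Finset (SpVar p n) :=
  {.inl (⟨ij.1.2 - ij.1.1, by omega⟩, ij.1.1), .inr (⟨ij.1.2 - ij.1.1, by omega⟩, ij.1.2)}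

theorem spLead_disjoint {p n : ℕ} (h : n ≤ p) :
    Pairwise (Function.onFun Disjoint (spLead (p := p) (n := n) h)) := by
  rintro ⟨⟨i, j⟩, hij⟩ ⟨⟨i', j'⟩, hij'⟩ hne
  simp only [ne_eq, Subtype.mk.injEq, Prod.mk.injEq, Fin.ext_iff] at hne hij hij' ⊢
  simp only [Function.onFun, spLead, Finset.disjoint_left, Finset.mem_insert,
    Finset.mem_singleton]
  have := Fin.lt_def.mp hij
  have := Fin.lt_def.mp hij'
  rintro _ (rfl | rfl) <;> simp [Fin.ext_iff] <;> omega

theorem monic_and_degree_spInvariant {p n : ℕ} (h : n ≤ p) (m : MonomialOrder (SpVar p n))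
    (ij : {ij : Fin n × Fin n // ij.1 < ij.2}) :
    (m.weighted (spWeight p n)).Monic (spInvariant p n ij) ∧
      (m.weighted (spWeight p n)).degree (spInvariant p n ij) =
        MonomialOrder.sqfreeExp (spLead h ij) := by
  apply m.monic_and_degree_of_weight
  obtain ⟨⟨i, j⟩, hij⟩ := ij
  have hlt := Fin.lt_def.mp hij
  have hj := j.2
  set k₀ : Fin p := ⟨j - i, by omega⟩ with hk₀
  have he : MonomialOrder.sqfreeExp (spLead h ⟨(i, j), hij⟩) =
      Finsupp.single (Sum.inl (k₀, i)) 1 + Finsupp.single (Sum.inr (k₀, j)) 1 := by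
    rw [spLead, MonomialOrder.sqfreeExp, Finset.sum_pair (by simp)]
  have hX (s t : SpVar p n) : (X s * X t : MvPolynomial (SpVar p n) ℂ) =
      monomial (Finsupp.single s 1 + Finsupp.single t 1) 1 := by
    simp [X, monomial_mul]
  have hk₀' : ((k₀ : ℕ) : ℤ) = j - i := by
    rw [hk₀]; push_cast [hlt.le]; ring
  rw [he, spInvariant, altForm, ← Finset.add_sum_erase _ _ (Finset.mem_univ k₀), ← hX,
    add_sub_right_comm]
  have key (s t : SpVar p n) (hst : spWeight p n s + spWeight p n t <
      spWeight p n (.inl (k₀, i)) + spWeight p n (.inr (k₀, j))) :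
      (X s * X t : MvPolynomial (SpVar p n) ℂ) ∈ restrictSupport ℂ
        {d | Finsupp.weight (spWeight p n) d < Finsupp.weight (spWeight p n)
          (Finsupp.single (Sum.inl (k₀, i)) 1 + Finsupp.single (Sum.inr (k₀, j)) 1)} := by
    rw [hX, mem_restrictSupport_iff]
    refine (Finset.coe_subset.mpr support_monomial_subset).trans ?_
    simpa [map_add, Finsupp.weight_single] using hst
  refine add_mem ?_ (sum_mem fun k hk => sub_mem (key _ _ ?_) (key _ _ ?_))
  · rw [sub_sub_cancel_left]
    refine neg_mem (key _ _ ?_)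
    zify
    simp only [spWeight_inl, spWeight_inr, hk₀']
    nlinarith
  · have hne : ((k : ℕ) : ℤ) - (j - i) ≠ 0 := by
      have := Finset.ne_of_mem_erase hk
      rw [ne_eq, Fin.ext_iff] at this
      omega
    have := pow_pos (abs_pos.mpr hne) 2
    rw [sq_abs] at this
    zify
    simp only [spWeight_inl, spWeight_inr, hk₀']
    nlinarith
  · zify
    simp only [spWeight_inl, spWeight_inr, hk₀']
    have h1 : (0 : ℤ) ≤ k := by positivity
    have h2 : (i : ℤ) < j := by exact_mod_cast hlt
    nlinarith [mul_nonneg h1 (sub_nonneg.mpr h2.le), sq_nonneg ((k : ℤ))]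

/-- The ideal generated by the universal quadratic invariants. -/
noncomputable def spIdeal (p n : ℕ) : Ideal (MvPolynomial (SpVar p n) ℂ) :=
  Ideal.span (Set.range (spInvariant p n))

theorem nonempty_monomialOrder.{u} (σ : Type u) [Finite σ] : Nonempty (MonomialOrder.{u, u} σ) := by
  have : Fintype σ := Fintype.ofFinite σ
  let : LinearOrder σ := LinearOrder.lift' (Fintype.equivFin σ) (Equiv.injective _)
  exact ⟨MonomialOrder.lex⟩

theorem inl_zero_notMem_spLead {p n : ℕ} (h : n ≤ p + 1) (i : Fin n)
    (ij : {ij : Fin n × Fin n // ij.1 < ij.2}) :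
    (.inl (0, i) : SpVar (p + 1) n) ∉ spLead h ij := by
  have := Fin.lt_def.mp ij.2
  simp [spLead, Fin.ext_iff]
  omega

theorem mem_spIdeal_of_X_mul_mem {p n : ℕ} (h : n ≤ p + 1) (i : Fin n)
    {g : MvPolynomial (SpVar (p + 1) n) ℂ}
    (hg : X (.inl (0, i)) * g ∈ spIdeal (p + 1) n) : g ∈ spIdeal (p + 1) n := by
  obtain ⟨m⟩ := nonempty_monomialOrder (SpVar (p + 1) n)
  exact (m.weighted (spWeight _ _)).mem_span_of_X_mul_mem
    (fun ij => (monic_and_degree_spInvariant h m ij).1)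
    (fun ij => (monic_and_degree_spInvariant h m ij).2)
    (fun ij => by simp [spLead]) (spLead_disjoint h) (inl_zero_notMem_spLead h i) hg

theorem isRadical_spIdeal_sup_span_X {p n : ℕ} (h : n ≤ p + 1) (i : Fin n) :
    (spIdeal (p + 1) n ⊔ Ideal.span {X (.inl (0, i))}).IsRadical := by
  obtain ⟨m⟩ := nonempty_monomialOrder (SpVar (p + 1) n)
  have : spIdeal (p + 1) n ⊔ Ideal.span {X (.inl (0, i))} =
      Ideal.span (Set.range fun o : Option _ =>
        o.elim (X (.inl (0, i))) (spInvariant (p + 1) n)) := by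
    rw [sup_comm, spIdeal, ← Ideal.span_union, Set.singleton_union]
    congr 1
    ext; simp [Option.exists, eq_comm]
  rw [this]
  refine (m.weighted (spWeight _ _)).isRadical_span_of_coprime
    (M := fun o => o.elim {.inl (0, i)} (spLead h)) ?_ ?_ ?_ ?_
  · rintro (_ | ij)
    · exact MonomialOrder.monic_X
    · exact (monic_and_degree_spInvariant h m ij).1
  · rintro (_ | ij)
    · simp [MonomialOrder.sqfreeExp, MonomialOrder.degree_X]
    · exact (monic_and_degree_spInvariant h m ij).2
  · rintro (_ | ij) <;> simp [spLead]
  · rintro (_ | ij) (_ | ij') hne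
    · exact absurd rfl hne
    · simpa [Function.onFun] using inl_zero_notMem_spLead h i ij'
    · simpa [Function.onFun] using inl_zero_notMem_spLead h i ij
    · exact spLead_disjoint h (by simpa using hne)

section altForm
variable {A B κ ι : Type*} [CommRing A] [CommRing B] [Fintype κ]

theorem map_altForm {F : Type*} [FunLike F A B] [RingHomClass F A B] (f : F) (u v : κ → ι → A)
    (i j : ι) :
    f (altForm u v i j) = altForm (fun k i => f (u k i)) (fun k i => f (v k i)) i j := by
  simp [altForm]

theorem altForm_self (u v : κ → ι → A) (i : ι) : altForm u v i i = 0 :=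
  Finset.sum_eq_zero fun k _ => by ring

theorem altForm_swap (u v : κ → ι → A) (i j : ι) : altForm u v j i = -altForm u v i j := by
  rw [altForm, altForm, ← Finset.sum_neg_distrib]
  exact Finset.sum_congr rfl fun k _ => by ring

theorem altForm_eq_zero [LinearOrder ι] {u v : κ → ι → A}
    (h : ∀ i j, i < j → altForm u v i j = 0) (i j : ι) : altForm u v i j = 0 := by
  obtain hij | rfl | hij := lt_trichotomy i j
  · exact h i j hij
  · exact altForm_self u v i
  · rw [altForm_swap, h j i hij, neg_zero]

variable {p n : ℕ}

theorem altForm_succ (u v : Fin (p + 1) → ι → A) (i j : ι) :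
    altForm u v i j = u 0 i * v 0 j - v 0 i * u 0 j +
      altForm (fun k : Fin p => u k.succ) (fun k : Fin p => v k.succ) i j := by
  simp only [altForm, Fin.sum_univ_succ]

/-- Extend a `p × n` matrix by a first row `x` and a first column `z`, after adding multiples of
the first column to the other ones. -/
def extendLeft (c : A) (x : Fin (n + 1) → A) (z : Fin p → A) (u : Fin p → Fin n → A) :
    Fin (p + 1) → Fin (n + 1) → A :=
  Fin.cons x fun k => Fin.cons (z k) fun j => u k j + c * x j.succ * z k

/-- The companion of `extendLeft`, with first row determined by the vanishing of the alternating
form. -/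
def extendRight (c : A) (x : Fin (n + 1) → A) (z : Fin p → A) (y : Fin (p + 1) → A)
    (u v : Fin p → Fin n → A) : Fin (p + 1) → Fin (n + 1) → A :=
  Fin.cons
    (Fin.cons (y 0) fun j => c * (y 0 * x j.succ - ∑ k, (z k * v k j - y k.succ * u k j)))
    fun k => Fin.cons (y k.succ) fun j => v k j + c * x j.succ * y k.succ

variable {c : A} {x : Fin (n + 1) → A} {z : Fin p → A} {y : Fin (p + 1) → A}
    {u v : Fin p → Fin n → A}

theorem altForm_extend (hc : x 0 * c = 1) (h : ∀ i j, altForm u v i j = 0) (i j : Fin (n + 1)) :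
    altForm (extendLeft c x z u) (extendRight c x z y u v) i j = 0 := by
  have h0 (j : Fin n) :
      altForm (extendLeft c x z u) (extendRight c x z y u v) 0 j.succ = 0 := by
    simp only [altForm, Fin.sum_univ_succ, extendLeft, extendRight, Fin.cons_zero, Fin.cons_succ]
    have : ∑ k, (z k * (v k j + c * x j.succ * y k.succ) -
        y k.succ * (u k j + c * x j.succ * z k)) = ∑ k, (z k * v k j - y k.succ * u k j) :=
      Finset.sum_congr rfl fun k _ => by ring
    rw [this]
    linear_combination (y 0 * x j.succ - ∑ k, (z k * v k j - y k.succ * u k j)) * hc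
  refine Fin.cases (Fin.cases (altForm_self _ _ _) h0 j) (fun i => Fin.cases ?_ (fun j => ?_) j) i
  · rw [altForm_swap, h0, neg_zero]
  · simp only [altForm, Fin.sum_univ_succ, extendLeft, extendRight, Fin.cons_zero, Fin.cons_succ]
    have : ∑ k, ((u k i + c * x i.succ * z k) * (v k j + c * x j.succ * y k.succ) -
        (v k i + c * x i.succ * y k.succ) * (u k j + c * x j.succ * z k)) =
        altForm u v i j - c * x j.succ * ∑ k, (z k * v k i - y k.succ * u k i) +
          c * x i.succ * ∑ k, (z k * v k j - y k.succ * u k j) := by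
      rw [altForm, Finset.mul_sum, Finset.mul_sum, ← Finset.sum_sub_distrib,
        ← Finset.sum_add_distrib]
      exact Finset.sum_congr rfl fun k _ => by ring
    rw [this, h]
    ring

/-- The inverse of the column operations in `extendLeft`. -/
def reduceColumns (c : A) (x : Fin (n + 1) → A) (u : Fin (p + 1) → Fin (n + 1) → A) :
    Fin p → Fin n → A :=
  fun k j => u k.succ j.succ - c * x j.succ * u k.succ 0

theorem sum_reduceColumns {u v : Fin (p + 1) → Fin (n + 1) → A}
    (h : ∀ i j, altForm u v i j = 0) (j : Fin n) :
    ∑ k : Fin p, (u k.succ 0 * reduceColumns c (u 0) v k j -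
      v k.succ 0 * reduceColumns c (u 0) u k j) = v 0 0 * u 0 j.succ - u 0 0 * v 0 j.succ := by
  have := h 0 j.succ
  rw [altForm, Fin.sum_univ_succ] at this
  rw [Finset.sum_congr rfl (g := fun k : Fin p => u k.succ 0 * v k.succ j.succ -
      v k.succ 0 * u k.succ j.succ) fun k _ => by rw [reduceColumns, reduceColumns]; ring]
  linear_combination this

theorem altForm_reduceColumns {u v : Fin (p + 1) → Fin (n + 1) → A} (hc : u 0 0 * c = 1)
    (h : ∀ i j, altForm u v i j = 0) (i j : Fin n) :
    altForm (reduceColumns c (u 0) u) (reduceColumns c (u 0) v) i j = 0 := by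
  have : altForm (reduceColumns c (u 0) u) (reduceColumns c (u 0) v) i j =
      (altForm u v i.succ j.succ - (u 0 i.succ * v 0 j.succ - v 0 i.succ * u 0 j.succ)) +
      c * u 0 j.succ * ∑ k : Fin p, (u k.succ 0 * reduceColumns c (u 0) v k i -
        v k.succ 0 * reduceColumns c (u 0) u k i) -
      c * u 0 i.succ * ∑ k : Fin p, (u k.succ 0 * reduceColumns c (u 0) v k j -
        v k.succ 0 * reduceColumns c (u 0) u k j) := by
    rw [altForm_succ, add_sub_cancel_left, altForm, altForm, Finset.mul_sum, Finset.mul_sum,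
      ← Finset.sum_add_distrib, ← Finset.sum_sub_distrib]
    refine Finset.sum_congr rfl fun k _ => ?_
    simp only [reduceColumns]
    ring
  rw [this, sum_reduceColumns h, sum_reduceColumns h, h]
  linear_combination (u 0 i.succ * v 0 j.succ - u 0 j.succ * v 0 i.succ) * hc

theorem extendLeft_reduceColumns (c : A) (u : Fin (p + 1) → Fin (n + 1) → A) :
    extendLeft c (u 0) (fun k => u k.succ 0) (reduceColumns c (u 0) u) = u := by
  funext k i
  refine Fin.cases rfl (fun k => Fin.cases rfl (fun i => ?_) i) k
  simp [extendLeft, reduceColumns]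

theorem extendRight_reduceColumns {u v : Fin (p + 1) → Fin (n + 1) → A} (hc : u 0 0 * c = 1)
    (h : ∀ i j, altForm u v i j = 0) :
    extendRight c (u 0) (fun k => u k.succ 0) (fun k => v k 0) (reduceColumns c (u 0) u)
      (reduceColumns c (u 0) v) = v := by
  funext k i
  refine Fin.cases (Fin.cases rfl (fun i => ?_) i) (fun k => Fin.cases rfl (fun i => ?_) i) k
  · simp only [extendRight, Fin.cons_zero, Fin.cons_succ, sum_reduceColumns h]
    linear_combination v 0 i.succ * hc
  · simp [extendRight, reduceColumns]

theorem map_extendLeft {F : Type*} [FunLike F A B] [RingHomClass F A B] (f : F)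
    (k : Fin (p + 1)) (i : Fin (n + 1)) :
    f (extendLeft c x z u k i) =
      extendLeft (f c) (fun i => f (x i)) (fun k => f (z k)) (fun k i => f (u k i)) k i := by
  refine Fin.cases rfl (fun k => Fin.cases rfl (fun i => ?_) i) k
  simp [extendLeft]

theorem map_extendRight {F : Type*} [FunLike F A B] [RingHomClass F A B] (f : F)
    (k : Fin (p + 1)) (i : Fin (n + 1)) :
    f (extendRight c x z y u v k i) =
      extendRight (f c) (fun i => f (x i)) (fun k => f (z k)) (fun k => f (y k))
        (fun k i => f (u k i)) (fun k i => f (v k i)) k i := by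
  refine Fin.cases (Fin.cases rfl (fun i => ?_) i) (fun k => Fin.cases rfl (fun i => ?_) i) k <;>
  simp [extendRight]

end altForm

/-- The coordinate ring of the null cone. -/
abbrev SpRing (p n : ℕ) : Type := MvPolynomial (SpVar p n) ℂ ⧸ spIdeal p n

namespace SpRing
variable {p n : ℕ} {A : Type*} [CommRing A] [Algebra ℂ A]

/-- The upper coordinates. -/
noncomputable def x (k : Fin p) (i : Fin n) : SpRing p n := Ideal.Quotient.mk _ (X (.inl (k, i)))

/-- The lower coordinates. -/
noncomputable def y (k : Fin p) (i : Fin n) : SpRing p n := Ideal.Quotient.mk _ (X (.inr (k, i)))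

theorem altForm_x_y (i j : Fin n) : altForm (A := SpRing p n) x y i j = 0 := by
  refine altForm_eq_zero (fun i j hij => ?_) i j
  have := Ideal.Quotient.eq_zero_iff_mem.mpr
    (Ideal.subset_span ⟨⟨(i, j), hij⟩, rfl⟩ : spInvariant p n ⟨(i, j), hij⟩ ∈ spIdeal p n)
  rwa [spInvariant, map_altForm] at this

/-- The universal property of the coordinate ring of the null cone. -/
noncomputable def lift (u v : Fin p → Fin n → A) (h : ∀ i j, altForm u v i j = 0) :
    SpRing p n →ₐ[ℂ] A :=
  Ideal.Quotient.liftₐ _ (aeval (Sum.elim (fun ki => u ki.1 ki.2) fun ki => v ki.1 ki.2))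
    fun a ha => by
      have : spIdeal p n ≤ RingHom.ker (aeval (R := ℂ)
          (Sum.elim (fun ki => u ki.1 ki.2) fun ki => v ki.1 ki.2)) := by
        rw [spIdeal, Ideal.span_le]
        rintro _ ⟨ij, rfl⟩
        simpa [RingHom.mem_ker, spInvariant, map_altForm] using h _ _
      exact this ha

@[simp]
theorem lift_x (u v : Fin p → Fin n → A) (h : ∀ i j, altForm u v i j = 0) (k : Fin p)
    (i : Fin n) : lift u v h (x k i) = u k i := by
  exact aeval_X _ _

@[simp]
theorem lift_y (u v : Fin p → Fin n → A) (h : ∀ i j, altForm u v i j = 0) (k : Fin p)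
    (i : Fin n) : lift u v h (y k i) = v k i := by
  exact aeval_X _ _

theorem algHom_ext {f g : SpRing p n →ₐ[ℂ] A} (hx : ∀ k i, f (x k i) = g (x k i))
    (hy : ∀ k i, f (y k i) = g (y k i)) : f = g := by
  refine Ideal.Quotient.algHom_ext _ (MvPolynomial.algHom_ext ?_)
  rintro (⟨k, i⟩ | ⟨k, i⟩)
  · exact hx k i
  · exact hy k i

end SpRing

namespace SpRing
variable {p n : ℕ}

/-- The free variables appearing when inverting the top left coordinate: the first row and the
first column of the upper coordinates, and the first column of the lower ones. -/
abbrev FreeVar (p n : ℕ) : Type := Fin (n + 1) ⊕ (Fin p ⊕ Fin (p + 1))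

/-- The coordinates on the open subset of the null cone where the top left coordinate is
invertible. -/
abbrev Chart (p n : ℕ) : Type := MvPolynomial (FreeVar p n) (SpRing p n)

/-- The coordinate ring of the open subset where the top left coordinate is invertible. -/
abbrev Away (p n : ℕ) : Type := Localization.Away (x 0 0 : SpRing (p + 1) (n + 1))

/-- The localization of `SpRing.Chart` at the variable corresponding to the top left coordinate. -/
abbrev ChartAway (p n : ℕ) : Type := Localization.Away (X (.inl 0) : Chart p n)

/-- The inclusion of the chart in its localization. -/
noncomputable abbrev toChartAway (p n : ℕ) : Chart p n →ₐ[ℂ] ChartAway p n :=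
  Algebra.algHom ℂ _ _

/-- The localization map. -/
noncomputable abbrev toAway (p n : ℕ) : SpRing (p + 1) (n + 1) →ₐ[ℂ] Away p n :=
  Algebra.algHom ℂ _ _

/-- The inverse of the top left coordinate. -/
noncomputable abbrev awayInv (p n : ℕ) : Away p n :=
  IsLocalization.Away.invSelf (x 0 0 : SpRing (p + 1) (n + 1))

/-- The inverse of the distinguished variable. -/
noncomputable abbrev chartInv (p n : ℕ) : ChartAway p n :=
  IsLocalization.Away.invSelf (X (.inl 0) : Chart p n)

theorem mul_chartInv (p n : ℕ) : toChartAway p n (X (.inl 0)) * chartInv p n = 1 :=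
  IsLocalization.Away.mul_invSelf (S := ChartAway p n) _

theorem mul_awayInv (p n : ℕ) : toAway p n (x 0 0) * awayInv p n = 1 :=
  IsLocalization.Away.mul_invSelf (S := Away p n) _

theorem algHom_away_ext {A : Type*} [CommRing A] [Algebra ℂ A] {f g : Away p n →ₐ[ℂ] A}
    (hx : ∀ k i, f (toAway p n (x k i)) = g (toAway p n (x k i)))
    (hy : ∀ k i, f (toAway p n (y k i)) = g (toAway p n (y k i))) : f = g :=
  Localization.algHom_ext _ (algHom_ext hx hy)

theorem algHom_chartAway_ext {A : Type*} [CommRing A] [Algebra ℂ A]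
    {f g : ChartAway p n →ₐ[ℂ] A}
    (hx : ∀ k i, f (toChartAway p n (C (x k i))) = g (toChartAway p n (C (x k i))))
    (hy : ∀ k i, f (toChartAway p n (C (y k i))) = g (toChartAway p n (C (y k i))))
    (hX : ∀ t, f (toChartAway p n (X t)) = g (toChartAway p n (X t))) : f = g :=
  Localization.algHom_ext _ (MvPolynomial.algHom_ext' (algHom_ext hx hy) hX)

theorem altForm_chart (i j : Fin n) :
    altForm (fun k i => toChartAway p n (C (x k i))) (fun k i => toChartAway p n (C (y k i))) i j
      = 0 := by
  have := congrArg (fun a => toChartAway p n (C a)) (altForm_x_y (p := p) i j)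
  simpa [altForm] using this

/-- The upper coordinates in terms of the chart. -/
noncomputable abbrev chartX (p n : ℕ) : Fin (p + 1) → Fin (n + 1) → ChartAway p n :=
  extendLeft (chartInv p n) (fun i => toChartAway p n (X (.inl i)))
    (fun k => toChartAway p n (X (.inr (.inl k)))) fun k i => toChartAway p n (C (x k i))

/-- The lower coordinates in terms of the chart. -/
noncomputable abbrev chartY (p n : ℕ) : Fin (p + 1) → Fin (n + 1) → ChartAway p n :=
  extendRight (chartInv p n) (fun i => toChartAway p n (X (.inl i)))
    (fun k => toChartAway p n (X (.inr (.inl k)))) (fun k => toChartAway p n (X (.inr (.inr k))))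
    (fun k i => toChartAway p n (C (x k i))) fun k i => toChartAway p n (C (y k i))

theorem altForm_chartX_chartY (i j : Fin (n + 1)) :
    altForm (chartX p n) (chartY p n) i j = 0 :=
  altForm_extend (mul_chartInv p n) altForm_chart i j

/-- Expressing the coordinates in terms of the chart. -/
noncomputable def awayToChartAway (p n : ℕ) : Away p n →ₐ[ℂ] ChartAway p n :=
  IsLocalization.liftAlgHom (M := Submonoid.powers (x 0 0 : SpRing (p + 1) (n + 1)))
    (f := lift (chartX p n) (chartY p n) altForm_chartX_chartY) (by
      rintro ⟨_, r, rfl⟩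
      rw [map_pow, lift_x]
      exact (IsUnit.of_mul_eq_one _ (mul_chartInv p n)).pow r)

theorem awayToChartAway_toAway (a : SpRing (p + 1) (n + 1)) :
    awayToChartAway p n (toAway p n a) =
      lift (chartX p n) (chartY p n) altForm_chartX_chartY a :=
  IsLocalization.lift_eq _ _

theorem altForm_away (i j : Fin (n + 1)) :
    altForm (fun k i => toAway p n (x k i)) (fun k i => toAway p n (y k i)) i j = 0 := by
  rw [← map_altForm (toAway p n), altForm_x_y, map_zero]

/-- The smaller upper coordinates on the open subset. -/
noncomputable abbrev awayX (p n : ℕ) : Fin p → Fin n → Away p n :=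
  reduceColumns (awayInv p n) (fun i => toAway p n (x 0 i)) fun k i => toAway p n (x k i)

/-- The smaller lower coordinates on the open subset. -/
noncomputable abbrev awayY (p n : ℕ) : Fin p → Fin n → Away p n :=
  reduceColumns (awayInv p n) (fun i => toAway p n (x 0 i)) fun k i => toAway p n (y k i)

theorem altForm_awayX_awayY (i j : Fin n) : altForm (awayX p n) (awayY p n) i j = 0 :=
  altForm_reduceColumns (u := fun k i => toAway p n (x k i)) (mul_awayInv p n) altForm_away i j

/-- Expressing the chart in terms of the coordinates, before localization. -/
noncomputable def chartToAway (p n : ℕ) : Chart p n →ₐ[ℂ] Away p n :=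
  aevalTower (lift (awayX p n) (awayY p n) altForm_awayX_awayY)
    (Sum.elim (fun i => toAway p n (x 0 i))
      (Sum.elim (fun k => toAway p n (x k.succ 0)) fun k => toAway p n (y k 0)))

/-- Expressing the chart in terms of the coordinates. -/
noncomputable def chartAwayToAway (p n : ℕ) : ChartAway p n →ₐ[ℂ] Away p n :=
  IsLocalization.liftAlgHom (M := Submonoid.powers (X (.inl 0) : Chart p n))
    (f := chartToAway p n) (by
      rintro ⟨_, r, rfl⟩
      rw [map_pow, chartToAway, aevalTower_X]
      exact (IsUnit.of_mul_eq_one _ (mul_awayInv p n)).pow r)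

theorem chartAwayToAway_toChartAway (a : Chart p n) :
    chartAwayToAway p n (toChartAway p n a) = chartToAway p n a :=
  IsLocalization.lift_eq _ _

theorem chartAwayToAway_chartInv : chartAwayToAway p n (chartInv p n) = awayInv p n := by
  have h := congrArg (chartAwayToAway p n) (mul_chartInv p n)
  rw [map_mul, map_one, chartAwayToAway_toChartAway, chartToAway, aevalTower_X] at h
  exact inv_unique h (mul_awayInv p n)

theorem awayToChartAway_awayInv : awayToChartAway p n (awayInv p n) = chartInv p n := by
  have h := congrArg (awayToChartAway p n) (mul_awayInv p n)
  rw [map_mul, map_one, awayToChartAway_toAway, lift_x] at h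
  exact inv_unique h (mul_chartInv p n)

/-- On the open subset where the top left coordinate is invertible, the null cone is the product
of a smaller null cone and an open subset of an affine space. -/
noncomputable def awayEquiv (p n : ℕ) : Away p n ≃ₐ[ℂ] ChartAway p n :=
  AlgEquiv.ofAlgHom (awayToChartAway p n) (chartAwayToAway p n)
    (by
      refine algHom_chartAway_ext (fun k i => ?_) (fun k i => ?_) (fun t => ?_)
      · simp only [AlgHom.comp_apply, AlgHom.id_apply, chartAwayToAway_toChartAway, chartToAway,
          aevalTower_C, lift_x, reduceColumns, map_sub, map_mul, awayToChartAway_awayInv,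
          awayToChartAway_toAway, extendLeft, Fin.cons_zero, Fin.cons_succ]
        ring
      · simp only [AlgHom.comp_apply, AlgHom.id_apply, chartAwayToAway_toChartAway, chartToAway,
          aevalTower_C, lift_x, lift_y, reduceColumns, map_sub, map_mul, awayToChartAway_awayInv,
          awayToChartAway_toAway, extendLeft, extendRight, Fin.cons_zero, Fin.cons_succ]
        ring
      · obtain i | k | k := t
        · simp [chartAwayToAway_toChartAway, chartToAway, awayToChartAway_toAway, extendLeft]
        · simp [chartAwayToAway_toChartAway, chartToAway, awayToChartAway_toAway, extendLeft]
        · refine Fin.cases ?_ (fun k => ?_) k <;>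
          simp [chartAwayToAway_toChartAway, chartToAway, awayToChartAway_toAway, extendRight])
    (by
      refine algHom_away_ext (fun k i => ?_) (fun k i => ?_)
      · rw [AlgHom.comp_apply, awayToChartAway_toAway, lift_x, map_extendLeft]
        simp only [chartAwayToAway_toChartAway, chartAwayToAway_chartInv, chartToAway,
          aevalTower_X, aevalTower_C, lift_x, Sum.elim_inl, Sum.elim_inr]
        exact congrFun₂ (extendLeft_reduceColumns (awayInv p n) fun k i => toAway p n (x k i)) k i
      · rw [AlgHom.comp_apply, awayToChartAway_toAway, lift_y, map_extendRight]
        simp only [chartAwayToAway_toChartAway, chartAwayToAway_chartInv, chartToAway,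
          aevalTower_X, aevalTower_C, lift_x, lift_y, Sum.elim_inl, Sum.elim_inr]
        exact congrFun₂ (extendRight_reduceColumns (u := fun k i => toAway p n (x k i))
          (mul_awayInv p n) altForm_away) k i)

end SpRing

theorem isIntegrallyClosed_of_away_equiv {A B L M : Type*} [CommRing A] [CommRing B] [CommRing L]
    [CommRing M] [Algebra A L] [Algebra B M] [IsDomain B] [IsIntegrallyClosed B] {a : A} {b : B}
    [IsLocalization.Away a L] [IsLocalization.Away b M] (e : L ≃+* M) (ha : a ∈ nonZeroDivisors A)
    (hred : (Ideal.span {a}).IsRadical) (hb : b ≠ 0) : IsDomain A ∧ IsIntegrallyClosed A := by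
  have hle : Submonoid.powers b ≤ nonZeroDivisors B := by
    simpa [Submonoid.powers_le] using hb
  have : IsDomain M := IsLocalization.isDomain_of_le_nonZeroDivisors M hle
  have : IsIntegrallyClosed M := isIntegrallyClosed_of_isLocalization M (Submonoid.powers b) hle
  have : IsDomain L := e.toMulEquiv.isDomain _
  have : IsIntegrallyClosed L := IsIntegrallyClosed.of_equiv e.symm
  exact isIntegrallyClosed_of_isLocalization_away (B := L) ha hred

theorem toNat_trdeg_eq_of_away (k A L : Type*) [Field k] [CommRing A] [CommRing L] [IsDomain A]
    [Algebra k A] [Algebra k L] [Algebra A L] [IsScalarTower k A L]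
    {a : A} (ha : a ≠ 0) [IsLocalization.Away a L] :
    Cardinal.toNat (Algebra.trdeg k A) = Cardinal.toNat (Algebra.trdeg k L) := by
  have hle : Submonoid.powers a ≤ nonZeroDivisors A := by
    simpa [Submonoid.powers_le] using ha
  have := IsLocalization.isDomain_of_le_nonZeroDivisors L hle
  have : FaithfulSMul A L := (faithfulSMul_iff_algebraMap_injective _ _).mpr
    (IsLocalization.injective L hle)
  have : Algebra.IsAlgebraic A L := IsLocalization.isAlgebraic _ (Submonoid.powers a)
  have h0 : Algebra.trdeg A L = 0 := trdeg_eq_zero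
  simpa [h0] using congrArg Cardinal.toNat (lift_trdeg_add_eq k A L)

theorem ringKrullDim_eq_of_away_algEquiv (k A B L M : Type*) [Field k] [CommRing A] [CommRing B]
    [CommRing L] [CommRing M] [IsDomain A] [IsDomain B] [Algebra k A] [Algebra k B] [Algebra k L]
    [Algebra k M] [Algebra A L] [Algebra B M] [IsScalarTower k A L] [IsScalarTower k B M]
    [Algebra.FiniteType k A] [Algebra.FiniteType k B] {a : A} {b : B} (ha : a ≠ 0) (hb : b ≠ 0)
    [IsLocalization.Away a L] [IsLocalization.Away b M] (e : L ≃ₐ[k] M) :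
    ringKrullDim A = ringKrullDim B := by
  have he := congrArg Cardinal.toNat e.lift_trdeg_eq
  rw [Cardinal.toNat_lift, Cardinal.toNat_lift] at he
  rw [ringKrullDim_eq_toNat_trdeg k (A := A), ringKrullDim_eq_toNat_trdeg k (A := B),
    toNat_trdeg_eq_of_away k A L ha, toNat_trdeg_eq_of_away k B M hb, he]

namespace SpRing
variable {p n : ℕ}

theorem x_mem_nonZeroDivisors (h : n ≤ p + 1) (i : Fin n) :
    (x 0 i : SpRing (p + 1) n) ∈ nonZeroDivisors (SpRing (p + 1) n) := by
  rw [mem_nonZeroDivisors_iff_right]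
  intro a ha
  obtain ⟨a, rfl⟩ := Ideal.Quotient.mk_surjective a
  rw [x, ← map_mul, mul_comm, Ideal.Quotient.eq_zero_iff_mem] at ha
  exact Ideal.Quotient.eq_zero_iff_mem.mpr (mem_spIdeal_of_X_mul_mem h i ha)

theorem isRadical_span_x (h : n ≤ p + 1) (i : Fin n) :
    (Ideal.span {(x 0 i : SpRing (p + 1) n)}).IsRadical := by
  have := isRadical_spIdeal_sup_span_X h i
  have hmap : Ideal.span {(x 0 i : SpRing (p + 1) n)} =
      (spIdeal (p + 1) n ⊔ Ideal.span {X (.inl (0, i))}).map (Ideal.Quotient.mk _) := by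
    rw [Ideal.map_sup, Ideal.map_quotient_self, bot_sup_eq, Ideal.map_span, Set.image_singleton, x]
  rintro a ⟨k, hk⟩
  obtain ⟨a, rfl⟩ := Ideal.Quotient.mk_surjective a
  rw [hmap, ← map_pow, Ideal.mem_quotient_iff_mem le_sup_left] at hk
  rw [hmap, Ideal.mem_quotient_iff_mem le_sup_left]
  exact this ⟨k, hk⟩

theorem isDomain_and_isIntegrallyClosed_succ (h : n ≤ p) [IsDomain (SpRing p n)]
    [IsIntegrallyClosed (SpRing p n)] :
    IsDomain (SpRing (p + 1) (n + 1)) ∧ IsIntegrallyClosed (SpRing (p + 1) (n + 1)) := by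
  have := MvPolynomial.isIntegrallyClosed (σ := FreeVar p n) (R := SpRing p n)
  exact isIntegrallyClosed_of_away_equiv (B := Chart p n) (awayEquiv p n).toRingEquiv
    (x_mem_nonZeroDivisors (by omega) 0) (isRadical_span_x (by omega) 0)
    (X_ne_zero (.inl 0))

theorem ringKrullDim_succ (h : n ≤ p) [IsDomain (SpRing p n)] [IsDomain (SpRing (p + 1) (n + 1))] :
    ringKrullDim (SpRing (p + 1) (n + 1)) = ringKrullDim (SpRing p n) + (2 * p + n + 2 : ℕ) := by
  have := ringKrullDim_eq_of_away_algEquiv ℂ (SpRing (p + 1) (n + 1)) (Chart p n) (Away p n)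
    (ChartAway p n) (nonZeroDivisors.ne_zero (x_mem_nonZeroDivisors (by omega) 0))
    (X_ne_zero (.inl 0)) (awayEquiv p n)
  rw [this, MvPolynomial.ringKrullDim_of_isNoetherianRing]
  congr 2
  simp
  ring

theorem isDomain_and_isIntegrallyClosed_and_ringKrullDim (h : n ≤ p) :
    IsDomain (SpRing p n) ∧ IsIntegrallyClosed (SpRing p n) ∧
      ringKrullDim (SpRing p n) = (2 * p * n - n * (n - 1) / 2 : ℕ) := by
  induction n generalizing p with
  | zero =>
    have hbot : spIdeal p 0 = ⊥ := by simp [spIdeal]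
    let e : SpRing p 0 ≃+* ℂ := ((Ideal.quotEquivOfEq hbot).trans (RingEquiv.quotientBot _)).trans
      (isEmptyRingEquiv ℂ _)
    refine ⟨e.toMulEquiv.isDomain _, IsIntegrallyClosed.of_equiv e.symm, ?_⟩
    rw [ringKrullDim_eq_of_ringEquiv e]
    simp
  | succ n ih =>
    obtain ⟨p, rfl⟩ : ∃ q, p = q + 1 := ⟨p - 1, by omega⟩
    have hnp : n ≤ p := by omega
    obtain ⟨_, _, hdim⟩ := ih hnp
    obtain ⟨_, hint⟩ := isDomain_and_isIntegrallyClosed_succ hnp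
    refine ⟨inferInstance, hint, ?_⟩
    rw [ringKrullDim_succ hnp, hdim, ← Nat.cast_add]
    congr 1
    have h1 : (n + 1) * (n + 1 - 1) / 2 = n * (n - 1) / 2 + n := by
      rw [← Nat.triangle_succ]
    have h2 : n * (n - 1) / 2 ≤ 2 * p * n := by
      refine (Nat.div_le_self _ _).trans ?_
      nlinarith [Nat.sub_le n 1]
    rw [h1]
    have h3 : 2 * (p + 1) * (n + 1) = 2 * p * n + 2 * p + 2 * n + 2 := by ring
    omega

end SpRing

/-- The rows of a `2p × n` matrix, split into the upper and lower ones. -/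
noncomputable def spVarEquiv (p n : ℕ) : SpVar p n ≃ Fin (2 * p) × Fin n :=
  Equiv.ofBijective
    (Sum.elim (fun ki => (finLow p ki.1, ki.2)) fun ki => (finHigh p ki.1, ki.2)) <| by
    constructor
    · rintro (⟨k, i⟩ | ⟨k, i⟩) (⟨l, j⟩ | ⟨l, j⟩) h <;>
      simp [finLow, finHigh, Fin.ext_iff] at h ⊢ <;> omega
    · rintro ⟨k, i⟩
      by_cases hk : (k : ℕ) < p
      · exact ⟨.inl (⟨k, hk⟩, i), rfl⟩
      · exact ⟨.inr (⟨k - p, by omega⟩, i), by simp [finHigh, Fin.ext_iff]; omega⟩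

@[simp]
theorem spVarEquiv_inl {p n : ℕ} (k : Fin p) (i : Fin n) :
    spVarEquiv p n (.inl (k, i)) = (finLow p k, i) := rfl

@[simp]
theorem spVarEquiv_inr {p n : ℕ} (k : Fin p) (i : Fin n) :
    spVarEquiv p n (.inr (k, i)) = (finHigh p k, i) := rfl

theorem nullConeIdealSp_eq_map (p n : ℕ) :
    nullConeIdealSp p n = (spIdeal p n).map (renameEquiv ℂ (spVarEquiv p n)).toRingEquiv := by
  rw [spIdeal, Ideal.map_span, nullConeIdealSp]
  congr 1
  ext f
  constructor
  · rintro ⟨i, j, hij, rfl⟩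
    refine ⟨_, ⟨⟨(i, j), hij⟩, rfl⟩, ?_⟩
    simp [spInvariant, altForm]
  · rintro ⟨_, ⟨⟨⟨i, j⟩, hij⟩, rfl⟩, rfl⟩
    refine ⟨i, j, hij, ?_⟩
    simp [spInvariant, altForm]

/-- In the stable range `n ≤ p`, the ideal of the null cone
`{A ∈ M_{2p,n}(ℂ) : AᵀJ_pA = 0}` is prime, its quotient ring is an integrally
closed integral domain of Krull dimension `2pn - n(n-1)/2`; i.e. the null cone is
an irreducible normal variety which is a set-theoretic complete intersection of
codimension `n(n-1)/2`. -/
theorem nullConeSp_prime_normal_dim (p n : ℕ) (hp : 0 < p) (hn : 0 < n) (h : n ≤ p) :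
    (nullConeIdealSp p n).IsPrime ∧
      IsDomain (MvPolynomial (Fin (2 * p) × Fin n) ℂ ⧸ nullConeIdealSp p n) ∧
      IsIntegrallyClosed (MvPolynomial (Fin (2 * p) × Fin n) ℂ ⧸ nullConeIdealSp p n) ∧
      ringKrullDim (MvPolynomial (Fin (2 * p) × Fin n) ℂ ⧸ nullConeIdealSp p n) =
        ((2 * p * n - n * (n - 1) / 2 : ℕ) : WithBot (WithTop ℕ)) := by
  let e := Ideal.quotientEquiv _ _ (renameEquiv ℂ (spVarEquiv p n)).toRingEquiv
    (nullConeIdealSp_eq_map p n)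
  obtain ⟨_, _, hdim⟩ := SpRing.isDomain_and_isIntegrallyClosed_and_ringKrullDim h
  have hdom : IsDomain (MvPolynomial (Fin (2 * p) × Fin n) ℂ ⧸ nullConeIdealSp p n) :=
    e.symm.toMulEquiv.isDomain _
  exact ⟨(Ideal.Quotient.isDomain_iff_prime _).mp hdom, hdom, IsIntegrallyClosed.of_equiv e,
    (ringKrullDim_eq_of_ringEquiv e).symm.trans hdim⟩
end
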